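/- arXiv:2508.09947 — 7 statements merged into one kernel-verified Lean document; each statement's English description precedes it below -/
import Mathlib

section
/- Let n and m be positive integers with n > (m-1)²/4. Then κ(√(n(n+m))) = 2n + m; that is, there exists a finite simple graph on 2n+m vertices whose spectral radius equals √(n(n+m)), and no graph on fewer vertices has this spectral radius. -/
open Polynomial

/-- The largest real eigenvalue of a real matrix (via `sSup` of the set of eigenvalues). -/
noncomputable def largestEig {V : Type} [Fintype V] [DecidableEq V] (M : Matrix V V ℝ) : ℝ :=
  sSup {μ : ℝ | Module.End.HasEigenvalue (Matrix.toLin' M) μ}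

/-- The spectral radius of a finite simple graph: the largest eigenvalue of its adjacency
matrix. -/
noncomputable def specRad {V : Type} [Fintype V] [DecidableEq V] (G : SimpleGraph V) : ℝ :=
  letI := Classical.decRel G.Adj
  largestEig (G.adjMatrix ℝ)

/-- The spectral radius order `κ(λ)`: the least number of vertices of a finite simple graph
with spectral radius `λ`, or `⊤` if there is no such graph. -/
noncomputable def kappa (lam : ℝ) : ℕ∞ :=
  sInf {m : ℕ∞ | ∃ n : ℕ, m = (n : ℕ∞) ∧ ∃ G : SimpleGraph (Fin n), specRad G = lam}

/-- A real number is a totally real algebraic integer if it is a root of a monic integer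
polynomial all of whose complex roots are real. -/
def IsTotallyRealAlgInt (x : ℝ) : Prop :=
  ∃ p : Polynomial ℤ, p.Monic ∧ Polynomial.aeval x p = 0 ∧
    ∀ z : ℂ, Polynomial.aeval z p = 0 → z.im = 0

lemma aux_lower {N : ℕ} (G : SimpleGraph (Fin N)) [DecidableRel G.Adj] (μ : ℝ)
    (h : Module.End.HasEigenvalue (Matrix.toLin' (G.adjMatrix ℝ)) μ) : -μ ≤ (N : ℝ) / 2 := by
  obtain ⟨x, hx⟩ := h.exists_hasEigenvector
  have hne := hx.2
  have hE := hx.apply_eq_smul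
  rw [Matrix.toLin'_apply] at hE
  have hpos : 0 < ∑ i, x i ^ 2 := by
    obtain ⟨i, hi⟩ := Function.ne_iff.mp hne
    have hi' : x i ≠ 0 := hi
    exact Finset.sum_pos' (fun i _ => sq_nonneg _) ⟨i, Finset.mem_univ _, by positivity⟩
  have h1 : μ * ∑ i, x i ^ 2 = ∑ i, ∑ j, G.adjMatrix ℝ i j * (x i * x j) := by
    rw [Finset.mul_sum]
    refine Finset.sum_congr rfl fun i _ => ?_
    have := congrFun hE i
    simp only [Matrix.mulVec, dotProduct, Pi.smul_apply, smul_eq_mul] at this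
    calc μ * x i ^ 2 = x i * (μ * x i) := by ring
      _ = _ := by
        rw [← this, Finset.mul_sum]
        exact Finset.sum_congr rfl fun j _ => by ring
  have h2 : ∑ i, ∑ j, (x i * x j - |x i| * |x j|) / 2 ≤
      ∑ i, ∑ j, G.adjMatrix ℝ i j * (x i * x j) := by
    refine Finset.sum_le_sum fun i _ => Finset.sum_le_sum fun j _ => ?_
    rw [← abs_mul, SimpleGraph.adjMatrix_apply]
    have ha := le_abs_self (x i * x j)
    have hb := neg_abs_le (x i * x j)
    split_ifs <;> linarith
  have h3 : ∑ i, ∑ j, (x i * x j - |x i| * |x j|) / 2 =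
      ((∑ i, x i) ^ 2 - (∑ i, |x i|) ^ 2) / 2 := by
    rw [sq, sq, Finset.sum_mul_sum, Finset.sum_mul_sum, ← Finset.sum_sub_distrib, Finset.sum_div]
    refine Finset.sum_congr rfl fun i _ => ?_
    rw [← Finset.sum_sub_distrib, Finset.sum_div]
  have h4 : (∑ i, |x i|) ^ 2 ≤ N * ∑ i, x i ^ 2 := by
    have := sq_sum_le_card_mul_sum_sq (s := Finset.univ) (f := fun i => |x i|)
    simpa using this
  by_contra hc
  push Not at hc
  nlinarith [sq_nonneg (∑ i, x i), mul_lt_mul_of_pos_right hc hpos]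

lemma aux_poly (l : ℝ) (D : ℤ) (hl : l ^ 2 = D) (p : ℤ[X]) :
    ∃ a b : ℤ, aeval l p = a + b * l ∧ aeval (-l) p = a - b * l := by
  induction p using Polynomial.induction_on with
  | C c => exact ⟨c, 0, by simp, by simp⟩
  | add p q hp hq =>
    obtain ⟨a, b, h1, h2⟩ := hp
    obtain ⟨c, d, h3, h4⟩ := hq
    refine ⟨a + c, b + d, ?_, ?_⟩
    · rw [map_add, h1, h3]; push_cast; ring
    · rw [map_add, h2, h4]; push_cast; ring
  | monomial k c ih =>
    obtain ⟨a, b, h1, h2⟩ := ih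
    refine ⟨b * D, a, ?_, ?_⟩
    · rw [pow_succ, ← mul_assoc, map_mul, h1, aeval_X]; push_cast; rw [← hl]; ring
    · rw [pow_succ, ← mul_assoc, map_mul, h2, aeval_X]; push_cast; rw [← hl]; ring

lemma aux_conj {N : ℕ} (G : SimpleGraph (Fin N)) [DecidableRel G.Adj] (l : ℝ) (D : ℤ)
    (hl : l ^ 2 = D) (hirr : Irrational l)
    (h : Module.End.HasEigenvalue (Matrix.toLin' (G.adjMatrix ℝ)) l) :
    Module.End.HasEigenvalue (Matrix.toLin' (G.adjMatrix ℝ)) (-l) := by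
  have hmap : (G.adjMatrix ℤ).map (Int.castRingHom ℝ) = G.adjMatrix ℝ := by
    ext i j
    simp [SimpleGraph.adjMatrix_apply]
  have hch : (G.adjMatrix ℝ).charpoly = (G.adjMatrix ℤ).charpoly.map (Int.castRingHom ℝ) := by
    rw [← Matrix.charpoly_map, hmap]
  have key : ∀ μ : ℝ, Module.End.HasEigenvalue (Matrix.toLin' (G.adjMatrix ℝ)) μ ↔
      aeval μ (G.adjMatrix ℤ).charpoly = 0 := by
    intro μ
    rw [Module.End.hasEigenvalue_iff_isRoot_charpoly, Matrix.charpoly_toLin', hch, IsRoot.def,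
      eval_map, aeval_def]
    rfl
  rw [key] at h ⊢
  obtain ⟨a, b, h1, h2⟩ := aux_poly l D hl (G.adjMatrix ℤ).charpoly
  rw [h1] at h
  have hb : b = 0 := by
    by_contra hb
    have := (hirr.intCast_mul hb).intCast_add a
    rw [h] at this
    exact this.ne_zero rfl
  subst hb
  rw [h2]
  simpa using h

lemma aux_eig {N : ℕ} (G : SimpleGraph (Fin N)) [DecidableRel G.Adj] (l : ℝ) (hl : 0 < l)
    (h : specRad G = l) :
    Module.End.HasEigenvalue (Matrix.toLin' (G.adjMatrix ℝ)) l := by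
  have h' : sSup {μ : ℝ | Module.End.HasEigenvalue (Matrix.toLin' (G.adjMatrix ℝ)) μ} = l := by
    rw [← h]; unfold specRad largestEig; congr!
  have hne : {μ : ℝ | Module.End.HasEigenvalue (Matrix.toLin' (G.adjMatrix ℝ)) μ}.Nonempty := by
    by_contra hc
    rw [Set.not_nonempty_iff_eq_empty] at hc
    rw [hc, Real.sSup_empty] at h'
    linarith
  have := hne.csSup_mem (Module.End.finite_hasEigenvalue _)
  rw [h'] at this
  exact this

/-- The complete bipartite graph on `Fin (n + k)`. -/
def bip (n k : ℕ) : SimpleGraph (Fin (n + k)) where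
  Adj i j := (i.val < n ∧ ¬ j.val < n) ∨ (¬ i.val < n ∧ j.val < n)
  symm := ⟨fun i j h => by tauto⟩
  loopless := ⟨fun i h => by tauto⟩

lemma bip_mulVec (n k : ℕ) [DecidableRel (bip n k).Adj] (x : Fin (n + k) → ℝ) :
    (∀ i : Fin n, ((bip n k).adjMatrix ℝ).mulVec x (Fin.castAdd k i) =
      ∑ j : Fin k, x (Fin.natAdd n j)) ∧
    (∀ j : Fin k, ((bip n k).adjMatrix ℝ).mulVec x (Fin.natAdd n j) =
      ∑ i : Fin n, x (Fin.castAdd k i)) := by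
  constructor <;> intro i <;>
  simp [Matrix.mulVec, dotProduct, Fin.sum_univ_add, SimpleGraph.adjMatrix_apply, bip]
  refine Finset.sum_eq_zero fun j _ => ?_
  rw [if_neg]
  have := i.2
  have := j.2
  omega

lemma bip_specRad (n k : ℕ) (hn : 0 < n) (hk : 0 < k) :
    specRad (bip n k) = Real.sqrt ((n : ℝ) * k) := by
  letI := Classical.decRel (bip n k).Adj
  change sSup {μ : ℝ | Module.End.HasEigenvalue (Matrix.toLin' ((bip n k).adjMatrix ℝ)) μ} = _
  have hn' : (0 : ℝ) < n := by exact_mod_cast hn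
  have hk' : (0 : ℝ) < k := by exact_mod_cast hk
  refine IsGreatest.csSup_eq ⟨?_, ?_⟩
  · let x : Fin (n + k) → ℝ := Fin.addCases (fun _ => Real.sqrt k) (fun _ => Real.sqrt n)
    refine Module.End.hasEigenvalue_of_hasEigenvector (x := x) ⟨?_, ?_⟩
    · rw [Module.End.mem_eigenspace_iff, Matrix.toLin'_apply]
      ext i
      have h1 := Real.mul_self_sqrt hn'.le
      have h2 := Real.mul_self_sqrt hk'.le
      refine Fin.addCases (fun i => ?_) (fun j => ?_) i
      · rw [(bip_mulVec n k x).1 i]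
        simp only [x, Fin.addCases_right, Fin.addCases_left, Finset.sum_const, Finset.card_univ,
          Fintype.card_fin, nsmul_eq_mul, Pi.smul_apply, smul_eq_mul, Real.sqrt_mul hn'.le]
        rw [mul_assoc, h2, mul_comm]
      · rw [(bip_mulVec n k x).2 j]
        simp only [x, Fin.addCases_right, Fin.addCases_left, Finset.sum_const, Finset.card_univ,
          Fintype.card_fin, nsmul_eq_mul, Pi.smul_apply, smul_eq_mul, Real.sqrt_mul hn'.le]
        rw [mul_right_comm, h1]
    · intro h0
      have := congrFun h0 (Fin.castAdd k ⟨0, hn⟩)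
      simp only [x, Fin.addCases_left, Pi.zero_apply] at this
      exact (Real.sqrt_pos.mpr hk').ne' this
  · intro μ hμ
    obtain ⟨x, hx⟩ := Module.End.HasEigenvalue.exists_hasEigenvector hμ
    have hne := hx.2
    have hE := hx.apply_eq_smul
    rw [Matrix.toLin'_apply] at hE
    obtain ⟨b1, b2⟩ := bip_mulVec n k x
    rw [hE] at b1 b2
    simp only [Pi.smul_apply, smul_eq_mul] at b1 b2
    set T := ∑ j : Fin k, x (Fin.natAdd n j) with hT
    set S := ∑ i : Fin n, x (Fin.castAdd k i) with hS
    have e1 : μ * S = n * T := by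
      rw [hS, Finset.mul_sum, Finset.sum_congr rfl fun i _ => b1 i]; simp
    have e2 : μ * T = k * S := by
      rw [hT, Finset.mul_sum, Finset.sum_congr rfl fun i _ => b2 i]; simp
    by_cases hμ0 : μ = 0
    · rw [hμ0]; positivity
    have hS0 : S ≠ 0 := by
      intro hS0
      rw [hS0] at e1 e2 b2
      have hT0 : T = 0 := by simpa [hμ0] using e2
      rw [hT0] at b1
      apply hne
      ext i
      refine Fin.addCases (fun i => ?_) (fun j => ?_) i
      · simpa [hμ0] using b1 i
      · simpa [hμ0] using b2 j
    apply Real.le_sqrt_of_sq_le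
    have : (μ ^ 2 - n * k) * S = 0 := by linear_combination μ * e1 + n * e2
    have := (mul_eq_zero.mp this).resolve_right hS0
    linarith

lemma aux_nonsq (n m : ℕ) (hn : 0 < n) (hm : 0 < m) (h : ((m : ℤ) - 1) ^ 2 < 4 * n) :
    ¬ IsSquare (n * (n + m)) := by
  rintro ⟨k, hk⟩
  have hkn : n < k := by
    by_contra hc
    push Not at hc
    nlinarith [Nat.mul_le_mul hc hc, Nat.mul_pos hn hm]
  obtain ⟨j, rfl⟩ := Nat.exists_eq_add_of_lt hkn
  have hk' : (n : ℤ) * (n + m) = (n + j + 1) * (n + j + 1) := by exact_mod_cast hk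
  have e : (n : ℤ) * (m - 2 * (j + 1)) = (j + 1) ^ 2 := by linear_combination hk'
  have hn' : (0 : ℤ) < n := by exact_mod_cast hn
  have hj : (0 : ℤ) ≤ j := by positivity
  have hp : 0 < (m : ℤ) - 2 * (j + 1) := by
    by_contra hc
    push Not at hc
    nlinarith
  have : (n : ℤ) ≤ (j + 1) ^ 2 := by nlinarith
  nlinarith

/-- If `n > (m-1)²/4` then `κ(√(n(n+m))) = 2n + m`. -/
theorem kappa_sqrt_n_mul_n_add_m (n m : ℕ) (hn : 0 < n) (hm : 0 < m)
    (h : ((m : ℝ) - 1) ^ 2 / 4 < (n : ℝ)) :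
    kappa (Real.sqrt ((n : ℝ) * ((n : ℝ) + (m : ℝ)))) = ((2 * n + m : ℕ) : ℕ∞) := by
  have hn' : (0 : ℝ) < n := by exact_mod_cast hn
  have hm' : (0 : ℝ) < m := by exact_mod_cast hm
  refine IsLeast.csInf_eq ⟨⟨n + (n + m), by congr 1; omega, bip n (n + m), ?_⟩, ?_⟩
  · rw [bip_specRad n (n + m) hn (by omega)]; push_cast; rfl
  · rintro _ ⟨N, rfl, G, hG⟩
    letI := Classical.decRel G.Adj
    set l := Real.sqrt ((n : ℝ) * ((n : ℝ) + (m : ℝ))) with hl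
    have hlpos : 0 < l := Real.sqrt_pos.mpr (by positivity)
    have hsq : l ^ 2 = (n : ℝ) * (n + m) := Real.sq_sqrt (by positivity)
    have hirr : Irrational l := by
      have : l = Real.sqrt ((n * (n + m) : ℕ) : ℝ) := by rw [hl]; push_cast; rfl
      rw [this, irrational_sqrt_natCast_iff]
      refine aux_nonsq n m hn hm ?_
      have : ((m : ℝ) - 1) ^ 2 < 4 * n := by linarith
      exact_mod_cast this
    have hE := aux_conj G l (n * (n + m)) (by rw [hsq]; push_cast; rfl) hirr (aux_eig G l hlpos hG)
    have hlow := aux_lower G _ hE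
    rw [neg_neg] at hlow
    by_contra hc
    have hc' : N + 1 ≤ 2 * n + m := by
      have := lt_of_not_ge hc
      exact_mod_cast this
    have hc2 : (N : ℝ) + 1 ≤ 2 * n + m := by exact_mod_cast hc'
    have : l ≤ (2 * n + m - 1) / 2 := by linarith
    nlinarith
end

section
/- Let n and m be positive integers with n > (m-1)² + 1. Then κ((n - m - 1 + √((n-m-1)² + 4m(n-m)))/2) = n; that is, there exists a finite simple graph on n vertices whose spectral radius equals (n - m - 1 + √((n-m-1)² + 4m(n-m)))/2, and no graph on fewer vertices has this spectral radius. -/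
open Polynomial

lemma eig_le {V : Type} [Fintype V] [DecidableEq V] (A : Matrix V V ℝ)
    (h0 : ∀ i j, 0 ≤ A i j) (hs : ∀ i j, A i j = A j i) (x : V → ℝ) (hx : ∀ i, 0 < x i)
    (c : ℝ) (hc : ∀ i, ∑ j, A i j * x j ≤ c * x i) (μ : ℝ)
    (hμ : Module.End.HasEigenvalue (Matrix.toLin' A) μ) : μ ≤ c := by
  obtain ⟨v, hv⟩ := hμ.exists_hasEigenvector
  have hv0 := hv.2
  have hev : ∀ i, ∑ j, A i j * v j = μ * v i := by
    intro i
    have := congrFun hv.apply_eq_smul i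
    simpa [Matrix.toLin'_apply, Matrix.mulVec, dotProduct] using this
  obtain ⟨i0, hi0⟩ := Function.ne_iff.mp hv0
  have hS : 0 < ∑ i, x i * |v i| := by
    apply Finset.sum_pos'
    · intro i _
      have := hx i
      positivity
    · exact ⟨i0, Finset.mem_univ _, mul_pos (hx i0) (abs_pos.mpr hi0)⟩
  have key : μ * ∑ i, x i * |v i| ≤ c * ∑ i, x i * |v i| := by
    calc μ * ∑ i, x i * |v i| = ∑ i, x i * (μ * |v i|) := by
          rw [Finset.mul_sum]; exact Finset.sum_congr rfl fun i _ => by ring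
      _ ≤ ∑ i, x i * ∑ j, A i j * |v j| := by
          apply Finset.sum_le_sum
          intro i _
          apply mul_le_mul_of_nonneg_left _ (hx i).le
          calc μ * |v i| ≤ |μ| * |v i| :=
                mul_le_mul_of_nonneg_right (le_abs_self _) (abs_nonneg _)
            _ = |∑ j, A i j * v j| := by rw [hev, abs_mul]
            _ ≤ ∑ j, |A i j * v j| := Finset.abs_sum_le_sum_abs _ _
            _ = ∑ j, A i j * |v j| :=
                Finset.sum_congr rfl fun j _ => by rw [abs_mul, abs_of_nonneg (h0 i j)]
      _ = ∑ j, |v j| * ∑ i, A j i * x i := by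
          simp_rw [Finset.mul_sum]
          rw [Finset.sum_comm]
          refine Finset.sum_congr rfl fun j _ => Finset.sum_congr rfl fun i _ => ?_
          rw [hs i j]; ring
      _ ≤ ∑ j, |v j| * (c * x j) :=
          Finset.sum_le_sum fun j _ => mul_le_mul_of_nonneg_left (hc j) (abs_nonneg _)
      _ = c * ∑ i, x i * |v i| := by
          rw [Finset.mul_sum]; exact Finset.sum_congr rfl fun i _ => by ring
  exact le_of_mul_le_mul_right key hS

lemma specRad_le {N : ℕ} (G : SimpleGraph (Fin N)) (c : ℝ) (hc0 : 0 ≤ c) (hc : (N : ℝ) - 1 ≤ c) :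
    specRad G ≤ c := by
  unfold specRad largestEig
  letI := Classical.decRel G.Adj
  apply Real.sSup_le _ hc0
  intro μ hμ
  refine eig_le _ ?_ ?_ (fun _ => 1) (fun _ => one_pos) c ?_ μ hμ
  · intro i j
    rw [SimpleGraph.adjMatrix_apply]
    split_ifs <;> norm_num
  · intro i j
    exact (SimpleGraph.isSymm_adjMatrix _).apply j i
  · intro i
    refine le_trans (b := ∑ j, (1 - if j = i then (1 : ℝ) else 0)) ?_ ?_
    · apply Finset.sum_le_sum
      intro j _
      rw [SimpleGraph.adjMatrix_apply]
      by_cases hij : j = i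
      · subst hij; simp
      · simp only [hij, if_false]
        split_ifs <;> norm_num
    · simp [Finset.sum_sub_distrib]
      linarith

def splitG (k m : ℕ) : SimpleGraph (Fin (k + m)) where
  Adj i j := i ≠ j ∧ (i.val < k ∨ j.val < k)
  symm := ⟨fun i j h => ⟨h.1.symm, h.2.symm⟩⟩
  loopless := ⟨fun i h => h.1 rfl⟩

lemma specRad_splitG (k m : ℕ) (hk : 0 < k) (lam : ℝ) (hl : 0 < lam)
    (hq : lam ^ 2 = ((k : ℝ) - 1) * lam + m * k) : specRad (splitG k m) = lam := by
  unfold specRad largestEig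
  letI := Classical.decRel (splitG k m).Adj
  have hk' : (0 : ℝ) < k := by exact_mod_cast hk
  let x : Fin (k + m) → ℝ := fun i => if i.val < k then lam else k
  have hx : ∀ i, 0 < x i := by
    intro i
    simp only [x]
    split_ifs <;> assumption
  have hA : ∀ i, ∑ j, (splitG k m).adjMatrix ℝ i j * x j = lam * x i := by
    intro i
    by_cases hi : i.val < k
    · have : ∀ j, (splitG k m).adjMatrix ℝ i j * x j = x j - if j = i then x i else 0 := by
        intro j
        rw [SimpleGraph.adjMatrix_apply]
        by_cases hij : j = i
        · subst hij; simp
        · have : (splitG k m).Adj i j := ⟨fun h => hij h.symm, Or.inl hi⟩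
          simp [hij, this]
      simp_rw [this]
      rw [Finset.sum_sub_distrib, Finset.sum_ite_eq' Finset.univ i, Fin.sum_univ_add]
      simp [x, hi]
      linarith
    · have : ∀ j, (splitG k m).adjMatrix ℝ i j * x j = if j.val < k then lam else 0 := by
        intro j
        rw [SimpleGraph.adjMatrix_apply]
        by_cases hj : j.val < k
        · have : (splitG k m).Adj i j := ⟨fun h => hi (h ▸ hj), Or.inr hj⟩
          simp [hj, this, x]
        · have : ¬ (splitG k m).Adj i j := fun h => h.2.elim hi hj
          simp [hj, this]
      simp_rw [this]
      rw [Fin.sum_univ_add]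
      simp [x, hi]
      ring
  have hmem : Module.End.HasEigenvalue (Matrix.toLin' ((splitG k m).adjMatrix ℝ)) lam := by
    apply Module.End.hasEigenvalue_of_hasEigenvector (x := x)
    rw [Module.End.hasEigenvector_iff, Module.End.mem_eigenspace_iff]
    constructor
    · funext i
      simpa [Matrix.toLin'_apply, Matrix.mulVec, dotProduct] using hA i
    · intro h0
      have := hx ⟨0, by omega⟩
      rw [h0] at this
      simp at this
  apply IsGreatest.csSup_eq
  refine ⟨hmem, fun μ hμ => ?_⟩
  refine eig_le _ ?_ ?_ x hx lam (fun i => (hA i).le) μ hμ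
  · intro i j
    rw [SimpleGraph.adjMatrix_apply]
    split_ifs <;> norm_num
  · intro i j
    exact (SimpleGraph.isSymm_adjMatrix _).apply j i

/-- If `n > (m-1)² + 1` then `κ((n - m - 1 + √((n-m-1)² + 4m(n-m)))/2) = n`. -/
theorem kappa_quadratic_family (n m : ℕ) (hn : 0 < n) (hm : 0 < m)
    (h : ((m : ℝ) - 1) ^ 2 + 1 < (n : ℝ)) :
    kappa (((n : ℝ) - (m : ℝ) - 1 +
        Real.sqrt (((n : ℝ) - (m : ℝ) - 1) ^ 2 + 4 * (m : ℝ) * ((n : ℝ) - (m : ℝ)))) / 2)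
      = (n : ℕ∞) := by
  have hmn : m < n := by
    have h' : ((m : ℤ) - 1) ^ 2 + 1 < (n : ℤ) := by exact_mod_cast h
    have : 0 ≤ ((m : ℤ) - 1) * (m - 2) := by
      obtain h1 | h1 : m = 1 ∨ 2 ≤ m := by omega
      · subst h1; simp
      · apply mul_nonneg <;> omega
    have : (m : ℤ) < n := by nlinarith
    exact_mod_cast this
  obtain ⟨k, rfl⟩ : ∃ k, n = k + m := ⟨n - m, by omega⟩
  have hk : 0 < k := by omega
  have hk1 : (1 : ℝ) ≤ k := by exact_mod_cast hk
  have hm1 : (1 : ℝ) ≤ m := by exact_mod_cast hm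
  push_cast at h ⊢
  have e : (k : ℝ) + m - m = k := by ring
  rw [e]
  have hD : (0 : ℝ) ≤ ((k : ℝ) - 1) ^ 2 + 4 * m * k := by positivity
  set s := Real.sqrt (((k : ℝ) - 1) ^ 2 + 4 * m * k) with hs
  have hs2 : s ^ 2 = ((k : ℝ) - 1) ^ 2 + 4 * m * k := Real.sq_sqrt hD
  have hs0 : 0 ≤ s := Real.sqrt_nonneg _
  have hspos : 0 < s := Real.sqrt_pos.mpr (by positivity)
  have hlow : (k : ℝ) + m - 2 < ((k : ℝ) - 1 + s) / 2 := by
    have : (k : ℝ) + 2 * m - 3 < s := Real.lt_sqrt_of_sq_lt (by nlinarith)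
    linarith
  unfold kappa
  apply le_antisymm
  · apply sInf_le
    refine ⟨k + m, by push_cast; rfl, splitG k m, specRad_splitG k m hk _ (by linarith) ?_⟩
    linear_combination hs2 / 4
  · apply le_sInf
    rintro _ ⟨N, rfl, G, hG⟩
    by_contra hlt
    have hN : N < k + m := by
      rw [not_le] at hlt
      exact_mod_cast hlt
    have hN' : (N : ℝ) + 1 ≤ k + m := by exact_mod_cast hN
    have := specRad_le G ((k : ℝ) + m - 2) (by linarith) (by linarith)
    linarith
end

section
/- If λ and λ' are real numbers each of which is the spectral radius of some finite simple graph, then λ + λ' is the spectral radius of some finite simple graph. (In particular, the set 𝕊 = {λ ∈ [0,∞) : κ(λ) < ∞} is closed under addition.) -/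
open Polynomial

lemma aux_hasEig {V : Type} [Fintype V] [DecidableEq V] (M : Matrix V V ℝ) (μ : ℝ) :
    Module.End.HasEigenvalue (Matrix.toLin' M) μ ↔ ∃ v : V → ℝ, v ≠ 0 ∧ M.mulVec v = μ • v := by
  constructor
  · intro h
    obtain ⟨v, hv⟩ := h.exists_hasEigenvector
    exact ⟨v, hv.2, by simpa using hv.apply_eq_smul⟩
  · rintro ⟨v, h0, hv⟩
    exact Module.End.hasEigenvalue_of_hasEigenvector (x := v)
      ⟨Module.End.mem_eigenspace_iff.2 (by simpa using hv), h0⟩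

lemma aux_greatest {V : Type} [Fintype V] [DecidableEq V] [Nonempty V] (M : Matrix V V ℝ)
    (hM : M.IsHermitian) :
    IsGreatest {μ : ℝ | Module.End.HasEigenvalue (Matrix.toLin' M) μ} (largestEig M) := by
  have hf : {μ : ℝ | Module.End.HasEigenvalue (Matrix.toLin' M) μ}.Finite :=
    Module.End.finite_hasEigenvalue _
  have hn : {μ : ℝ | Module.End.HasEigenvalue (Matrix.toLin' M) μ}.Nonempty := by
    obtain ⟨i⟩ := ‹Nonempty V›
    refine ⟨hM.eigenvalues i, (aux_hasEig _ _).2 ⟨(hM.eigenvectorBasis i).ofLp, ?_, ?_⟩⟩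
    · intro h
      exact hM.eigenvectorBasis.orthonormal.ne_zero i (by ext j; exact congrFun h j)
    · simpa using hM.mulVec_eigenvectorBasis i
  exact ⟨hn.csSup_mem hf, fun x hx => le_csSup hf.bddAbove hx⟩

lemma aux_psd {V : Type} [Fintype V] [DecidableEq V] [Nonempty V] (M : Matrix V V ℝ)
    (hM : M.IsHermitian) (v : V → ℝ) :
    v ⬝ᵥ M.mulVec v ≤ largestEig M * (v ⬝ᵥ v) := by
  have hH : (largestEig M • (1 : Matrix V V ℝ) - M).IsHermitian := by
    have h1 : (1 : Matrix V V ℝ).IsHermitian := Matrix.isHermitian_one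
    unfold Matrix.IsHermitian at *
    rw [Matrix.conjTranspose_sub, Matrix.conjTranspose_smul, h1, hM]; simp
  have hp : (largestEig M • (1 : Matrix V V ℝ) - M).PosSemidef := by
    rw [hH.posSemidef_iff_eigenvalues_nonneg]
    intro i
    have h1 := hH.mulVec_eigenvectorBasis i
    have h2 : Module.End.HasEigenvalue (Matrix.toLin' M) (largestEig M - hH.eigenvalues i) := by
      refine (aux_hasEig _ _).2 ⟨(hH.eigenvectorBasis i).ofLp, ?_, ?_⟩
      · intro h
        exact hH.eigenvectorBasis.orthonormal.ne_zero i (by ext j; exact congrFun h j)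
      · rw [Matrix.sub_mulVec, Matrix.smul_mulVec, Matrix.one_mulVec] at h1
        rw [sub_smul, ← h1]; simp
    have := (aux_greatest M hM).2 h2
    simp only [Pi.zero_apply]
    linarith
  have := hp.dotProduct_mulVec_nonneg v
  rw [Matrix.sub_mulVec, Matrix.smul_mulVec, Matrix.one_mulVec] at this
  simp [dotProduct_sub] at this
  linarith

open Classical in
lemma aux_eq {V : Type} [Fintype V] [DecidableEq V] (G : SimpleGraph V) :
    specRad G = largestEig (G.adjMatrix ℝ) := by
  unfold specRad
  congr!

open Classical in
lemma aux_box {m n : ℕ} [NeZero m] [NeZero n] (G : SimpleGraph (Fin m)) (H : SimpleGraph (Fin n)) :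
    largestEig ((G.boxProd H).adjMatrix ℝ)
      = largestEig (G.adjMatrix ℝ) + largestEig (H.adjMatrix ℝ) := by
  have hA : (G.adjMatrix ℝ).IsHermitian := by
    ext i j; simp [SimpleGraph.adj_comm]
  have hB : (H.adjMatrix ℝ).IsHermitian := by
    ext i j; simp [SimpleGraph.adj_comm]
  have key : ∀ (x : Fin m × Fin n → ℝ) (i : Fin m) (j : Fin n),
      ((G.boxProd H).adjMatrix ℝ).mulVec x (i, j) =
        (G.adjMatrix ℝ).mulVec (fun k => x (k, j)) i
        + (H.adjMatrix ℝ).mulVec (fun l => x (i, l)) j := by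
    intro x i j
    have e : ∀ k l, (G.boxProd H).adjMatrix ℝ (i, j) (k, l) =
        (if j = l then G.adjMatrix ℝ i k else 0) + (if i = k then H.adjMatrix ℝ j l else 0) := by
      intro k l
      simp only [SimpleGraph.adjMatrix_apply, SimpleGraph.boxProd_adj]
      by_cases h1 : j = l <;> by_cases h2 : i = k <;> simp [h1, h2]
    simp only [Matrix.mulVec, dotProduct, Fintype.sum_prod_type, e, add_mul, Finset.sum_add_distrib]
    congr 1
    · simp
    · rw [Finset.sum_comm]; simp
  refine IsGreatest.csSup_eq ⟨?_, ?_⟩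
  · obtain ⟨u, hu0, hu⟩ := (aux_hasEig _ _).1 (aux_greatest _ hA).1
    obtain ⟨v, hv0, hv⟩ := (aux_hasEig _ _).1 (aux_greatest _ hB).1
    refine (aux_hasEig _ _).2 ⟨fun p => u p.1 * v p.2, ?_, ?_⟩
    · obtain ⟨i, hi⟩ := Function.ne_iff.1 hu0
      obtain ⟨j, hj⟩ := Function.ne_iff.1 hv0
      exact Function.ne_iff.2 ⟨(i, j), mul_ne_zero hi hj⟩
    · ext ⟨i, j⟩
      rw [key]
      have h1 : (fun k => u k * v j) = v j • u := by ext; simp [mul_comm]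
      have h2 : (fun l => u i * v l) = u i • v := by ext; simp
      simp only [h1, h2, Matrix.mulVec_smul, hu, hv, Pi.smul_apply, smul_eq_mul]
      ring
  · intro μ hμ
    obtain ⟨x, hx0, hx⟩ := (aux_hasEig _ _).1 hμ
    have hpos : 0 < x ⬝ᵥ x := by
      obtain ⟨i, hi⟩ := Function.ne_iff.1 hx0
      exact Finset.sum_pos' (fun i _ => mul_self_nonneg _)
        ⟨i, Finset.mem_univ _, mul_self_pos.2 hi⟩
    have h1 : x ⬝ᵥ ((G.boxProd H).adjMatrix ℝ).mulVec x = μ * (x ⬝ᵥ x) := by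
      rw [hx]; simp
    have h2 : x ⬝ᵥ ((G.boxProd H).adjMatrix ℝ).mulVec x =
        (∑ j, (fun k => x (k, j)) ⬝ᵥ (G.adjMatrix ℝ).mulVec (fun k => x (k, j)))
        + ∑ i, (fun l => x (i, l)) ⬝ᵥ (H.adjMatrix ℝ).mulVec (fun l => x (i, l)) := by
      rw [dotProduct, Fintype.sum_prod_type]
      simp only [key, mul_add, Finset.sum_add_distrib]
      congr 1
      rw [Finset.sum_comm]; rfl
    have h3 : x ⬝ᵥ x = ∑ j, (fun k => x (k, j)) ⬝ᵥ (fun k => x (k, j)) := by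
      rw [dotProduct, Fintype.sum_prod_type, Finset.sum_comm]; rfl
    have h4 : x ⬝ᵥ x = ∑ i, (fun l => x (i, l)) ⬝ᵥ (fun l => x (i, l)) := by
      rw [dotProduct, Fintype.sum_prod_type]; rfl
    have h5 := Finset.sum_le_sum (s := Finset.univ)
      (fun j _ => aux_psd _ hA (fun k => x (k, j)))
    have h6 := Finset.sum_le_sum (s := Finset.univ)
      (fun i _ => aux_psd _ hB (fun l => x (i, l)))
    rw [← Finset.mul_sum, ← h3] at h5
    rw [← Finset.mul_sum, ← h4] at h6
    refine le_of_mul_le_mul_right ?_ hpos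
    linarith

open Classical in
lemma aux_comap {V W : Type} [Fintype V] [DecidableEq V] [Fintype W] [DecidableEq W]
    (e : V ≃ W) (G : SimpleGraph W) :
    largestEig ((G.comap e).adjMatrix ℝ) = largestEig (G.adjMatrix ℝ) := by
  have key : ∀ x : W → ℝ, ((G.comap e).adjMatrix ℝ).mulVec (x ∘ e)
      = (G.adjMatrix ℝ).mulVec x ∘ e := by
    intro x
    ext i
    simp only [Matrix.mulVec, dotProduct, Function.comp, SimpleGraph.adjMatrix_apply,
      SimpleGraph.comap_adj]
    exact Equiv.sum_comp e (fun j => (if G.Adj (e i) j then (1 : ℝ) else 0) * x j)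
  unfold largestEig
  congr 1
  ext μ
  simp only [Set.mem_setOf_eq, aux_hasEig]
  constructor
  · rintro ⟨v, h0, hv⟩
    have hve : v = (v ∘ e.symm) ∘ e := by ext; simp
    refine ⟨v ∘ e.symm, ?_, ?_⟩
    · intro h; apply h0; rw [hve, h]; rfl
    · rw [hve, key] at hv
      ext i
      simpa using congrFun hv (e.symm i)
  · rintro ⟨v, h0, hv⟩
    refine ⟨v ∘ e, ?_, ?_⟩
    · intro h; apply h0; ext i; simpa using congrFun h (e.symm i)
    · rw [key, hv]; rfl

lemma aux_zero (G : SimpleGraph (Fin 0)) : specRad G = 0 := by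
  rw [aux_eq, largestEig]
  convert Real.sSup_empty
  ext μ
  simp only [Set.mem_setOf_eq, aux_hasEig, Set.mem_empty_iff_false, iff_false]
  rintro ⟨v, h0, -⟩
  exact h0 (Subsingleton.elim _ _)

/-- The set of spectral radii of finite simple graphs is closed under addition. -/
theorem specRad_closed_under_add (lam lam' : ℝ)
    (h : ∃ (n : ℕ) (G : SimpleGraph (Fin n)), specRad G = lam)
    (h' : ∃ (n : ℕ) (G : SimpleGraph (Fin n)), specRad G = lam') :
    ∃ (n : ℕ) (G : SimpleGraph (Fin n)), specRad G = lam + lam' := by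
  obtain ⟨m, G, rfl⟩ := h
  obtain ⟨n, H, rfl⟩ := h'
  rcases Nat.eq_zero_or_pos m with rfl | hm
  · exact ⟨n, H, by rw [aux_zero G, zero_add]⟩
  rcases Nat.eq_zero_or_pos n with rfl | hn
  · exact ⟨m, G, by rw [aux_zero H, add_zero]⟩
  have : NeZero m := ⟨hm.ne'⟩
  have : NeZero n := ⟨hn.ne'⟩
  refine ⟨m * n, (G.boxProd H).comap finProdFinEquiv.symm, ?_⟩
  rw [aux_eq, aux_eq, aux_eq, ← aux_box]
  exact aux_comap finProdFinEquiv.symm (G.boxProd H)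
end

section
/- If λ and λ' are real numbers each of which is the spectral radius of some finite simple graph, then λ · λ' is the spectral radius of some finite simple graph. (In particular, the set 𝕊 = {λ ∈ [0,∞) : κ(λ) < ∞} is closed under multiplication.) -/
open Polynomial

open Matrix Kronecker in
theorem hasEig_iff {V : Type} [Fintype V] [DecidableEq V] (M : Matrix V V ℝ) (μ : ℝ) :
    Module.End.HasEigenvalue (Matrix.toLin' M) μ ↔ ∃ x : V → ℝ, x ≠ 0 ∧ M *ᵥ x = μ • x := by
  constructor
  · intro h
    obtain ⟨x, hx⟩ := h.exists_hasEigenvector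
    exact ⟨x, hx.2, by simpa using hx.apply_eq_smul⟩
  · rintro ⟨x, hx, h⟩
    exact Module.End.hasEigenvalue_of_hasEigenvector (x := x)
      ⟨Module.End.mem_eigenspace_iff.2 (by simpa using h), hx⟩

open Matrix Kronecker in
theorem eig_le_of_psd {V : Type} [Fintype V] [DecidableEq V] (M : Matrix V V ℝ) (l μ : ℝ)
    (hp : (l • (1 : Matrix V V ℝ) - M).PosSemidef) (x : V → ℝ) (hx : x ≠ 0)
    (h : M *ᵥ x = μ • x) : μ ≤ l := by
  have h1 := hp.dotProduct_mulVec_nonneg x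
  rw [sub_mulVec, h, smul_mulVec, one_mulVec, ← sub_smul, dotProduct_smul, smul_eq_mul] at h1
  have h2 : 0 < star x ⬝ᵥ x := dotProduct_star_self_pos_iff.2 hx
  by_contra! hc
  nlinarith

open Matrix Kronecker in
theorem largestEig_eq {V : Type} [Fintype V] [DecidableEq V] (M : Matrix V V ℝ) (l : ℝ)
    (hp : (l • (1 : Matrix V V ℝ) - M).PosSemidef) (x : V → ℝ) (hx : x ≠ 0)
    (h : M *ᵥ x = l • x) : largestEig M = l := by
  have : IsGreatest {μ : ℝ | Module.End.HasEigenvalue (Matrix.toLin' M) μ} l := by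
    refine ⟨(hasEig_iff M l).2 ⟨x, hx, h⟩, ?_⟩
    intro μ hμ
    obtain ⟨y, hy, h'⟩ := (hasEig_iff M μ).1 hμ
    exact eig_le_of_psd M l μ hp y hy h'
  exact this.csSup_eq

open Matrix Kronecker in
theorem largestEig_spec {V : Type} [Fintype V] [DecidableEq V] [Nonempty V] (M : Matrix V V ℝ)
    (hM : M.IsHermitian) (h0 : ∀ i j, 0 ≤ M i j) :
    (∃ x : V → ℝ, x ≠ 0 ∧ M *ᵥ x = largestEig M • x) ∧
    (largestEig M • (1 : Matrix V V ℝ) - M).PosSemidef ∧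
    (largestEig M • (1 : Matrix V V ℝ) + M).PosSemidef := by
  set S := {μ : ℝ | Module.End.HasEigenvalue (Matrix.toLin' M) μ} with hS
  have hfin : S.Finite := Module.End.finite_hasEigenvalue _
  have hne : S.Nonempty := by
    obtain ⟨i⟩ := ‹Nonempty V›
    refine ⟨hM.eigenvalues i, (hasEig_iff _ _).2 ⟨_, ?_, hM.mulVec_eigenvectorBasis i⟩⟩
    intro h
    apply hM.eigenvectorBasis.orthonormal.ne_zero i
    ext j
    exact congrFun h j
  have hmem : largestEig M ∈ S := hne.csSup_mem hfin
  have hle : ∀ μ ∈ S, μ ≤ largestEig M := fun μ h => le_csSup hfin.bddAbove h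
  have hD : (largestEig M • (1 : Matrix V V ℝ)).IsHermitian := by
    simp [IsHermitian]
  have hp : (largestEig M • (1 : Matrix V V ℝ) - M).PosSemidef := by
    have hH := hD.sub hM
    rw [hH.posSemidef_iff_eigenvalues_nonneg]
    intro i
    have h1 := hH.mulVec_eigenvectorBasis i
    have h2 := hle (largestEig M - hH.eigenvalues i) ((hasEig_iff _ _).2
      ⟨(hH.eigenvectorBasis i).ofLp, ?_, ?_⟩)
    · simp only [Pi.zero_apply]; linarith
    · intro h
      apply hH.eigenvectorBasis.orthonormal.ne_zero i
      ext j
      exact congrFun h j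
    · rw [sub_mulVec, smul_mulVec, one_mulVec] at h1
      rw [sub_smul, ← h1]; abel
  refine ⟨(hasEig_iff _ _).1 hmem, hp, ?_⟩
  refine PosSemidef.of_dotProduct_mulVec_nonneg (hD.add hM) fun x => ?_
  have h1 := hp.dotProduct_mulVec_nonneg (fun i => |x i|)
  rw [sub_mulVec, smul_mulVec, one_mulVec, dotProduct_sub, dotProduct_smul, smul_eq_mul] at h1
  rw [add_mulVec, smul_mulVec, one_mulVec, dotProduct_add, dotProduct_smul, smul_eq_mul]
  have e1 : star (fun i => |x i|) ⬝ᵥ (fun i => |x i|) = star x ⬝ᵥ x := by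
    simp [dotProduct]
  have e2 : -(star (fun i => |x i|) ⬝ᵥ (M *ᵥ fun i => |x i|)) ≤ star x ⬝ᵥ (M *ᵥ x) := by
    simp only [dotProduct, mulVec, Finset.mul_sum, ← Finset.sum_neg_distrib, Pi.star_apply,
      star_trivial]
    refine Finset.sum_le_sum fun i _ => Finset.sum_le_sum fun j _ => ?_
    have := neg_abs_le (x i * (M i j * x j))
    rwa [abs_mul, abs_mul, abs_of_nonneg (h0 i j)] at this
  rw [e1] at h1
  linarith

open Matrix Kronecker in
theorem kron_psd {V W : Type} [Fintype V] [DecidableEq V] [Fintype W] [DecidableEq W]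
    (A : Matrix V V ℝ) (B : Matrix W W ℝ) (a b : ℝ)
    (h1 : (a • (1 : Matrix V V ℝ) - A).PosSemidef) (h2 : (a • (1 : Matrix V V ℝ) + A).PosSemidef)
    (h3 : (b • (1 : Matrix W W ℝ) - B).PosSemidef) (h4 : (b • (1 : Matrix W W ℝ) + B).PosSemidef) :
    ((a * b) • (1 : Matrix (V × W) (V × W) ℝ) - A ⊗ₖ B).PosSemidef := by
  have h := ((h1.kronecker h4).add (h2.kronecker h3)).smul (show (0 : ℝ) ≤ 1 / 2 by norm_num)
  have e : (a * b) • (1 : Matrix (V × W) (V × W) ℝ) - A ⊗ₖ B = (1 / 2 : ℝ) •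
      ((a • (1 : Matrix V V ℝ) - A) ⊗ₖ (b • (1 : Matrix W W ℝ) + B) +
        (a • (1 : Matrix V V ℝ) + A) ⊗ₖ (b • (1 : Matrix W W ℝ) - B)) := by
    ext ⟨i, j⟩ ⟨k, l⟩
    simp only [← one_kronecker_one, Matrix.sub_apply, Matrix.add_apply, Matrix.smul_apply,
      kroneckerMap_apply, smul_eq_mul]
    ring
  rw [e]
  exact h

/-- The set of spectral radii of finite simple graphs is closed under multiplication. -/
theorem specRad_closed_under_mul (lam lam' : ℝ)
    (h : ∃ (n : ℕ) (G : SimpleGraph (Fin n)), specRad G = lam)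
    (h' : ∃ (n : ℕ) (G : SimpleGraph (Fin n)), specRad G = lam') :
    ∃ (n : ℕ) (G : SimpleGraph (Fin n)), specRad G = lam * lam' := by
  classical
  obtain ⟨n, G, rfl⟩ := h
  obtain ⟨m, H, rfl⟩ := h'
  have hz : ∀ G : SimpleGraph (Fin 0), specRad G = 0 := by
    intro G
    have : {μ : ℝ | Module.End.HasEigenvalue (Matrix.toLin'
        (letI := Classical.decRel G.Adj; G.adjMatrix ℝ)) μ} = ∅ := by
      ext μ
      simp only [Set.mem_setOf_eq, Set.mem_empty_iff_false, iff_false, hasEig_iff]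
      rintro ⟨x, hx, -⟩
      exact hx (Subsingleton.elim _ _)
    unfold specRad largestEig
    simp only [this, Real.sSup_empty]
  rcases Nat.eq_zero_or_pos n with rfl | hn
  · exact ⟨0, G, by simp [hz]⟩
  rcases Nat.eq_zero_or_pos m with rfl | hm
  · exact ⟨0, H, by simp [hz]⟩
  have : Nonempty (Fin n) := ⟨⟨0, hn⟩⟩
  have : Nonempty (Fin m) := ⟨⟨0, hm⟩⟩
  let e : Fin (n * m) ≃ Fin n × Fin m := finProdFinEquiv.symm
  let K : SimpleGraph (Fin (n * m)) :=
    { Adj := fun p q => G.Adj (e p).1 (e q).1 ∧ H.Adj (e p).2 (e q).2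
      symm := ⟨fun p q h => ⟨h.1.symm, h.2.symm⟩⟩
      loopless := ⟨fun p h => G.loopless.irrefl _ h.1⟩ }
  refine ⟨n * m, K, ?_⟩
  unfold specRad
  letI := Classical.decRel G.Adj
  letI := Classical.decRel H.Adj
  letI := Classical.decRel K.Adj
  change largestEig (K.adjMatrix ℝ) = largestEig (G.adjMatrix ℝ) * largestEig (H.adjMatrix ℝ)
  obtain ⟨⟨x, hx, hxe⟩, p1, p2⟩ := largestEig_spec (G.adjMatrix ℝ)
    (by simp [Matrix.IsHermitian, Matrix.conjTranspose_eq_transpose_of_trivial])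
    (by intro i j; rw [SimpleGraph.adjMatrix_apply]; split_ifs <;> norm_num)
  obtain ⟨⟨y, hy, hye⟩, p3, p4⟩ := largestEig_spec (H.adjMatrix ℝ)
    (by simp [Matrix.IsHermitian, Matrix.conjTranspose_eq_transpose_of_trivial])
    (by intro i j; rw [SimpleGraph.adjMatrix_apply]; split_ifs <;> norm_num)
  have hK : ∀ p q, K.adjMatrix ℝ p q =
      G.adjMatrix ℝ (e p).1 (e q).1 * H.adjMatrix ℝ (e p).2 (e q).2 := by
    intro p q
    simp only [SimpleGraph.adjMatrix_apply, K]
    by_cases h1 : G.Adj (e p).1 (e q).1 <;> by_cases h2 : H.Adj (e p).2 (e q).2 <;> simp [h1, h2]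
  refine largestEig_eq _ _ ?_ (fun p => x (e p).1 * y (e p).2) ?_ ?_
  · convert (kron_psd _ _ _ _ p1 p2 p3 p4).submatrix e using 1
    ext p q
    simp [hK, Matrix.one_apply, -SimpleGraph.adjMatrix_apply]
  · intro h
    obtain ⟨i, hi⟩ := Function.ne_iff.1 hx
    obtain ⟨j, hj⟩ := Function.ne_iff.1 hy
    have := congrFun h (e.symm (i, j))
    simp only [Equiv.apply_symm_apply, Pi.zero_apply, mul_eq_zero] at this
    exact this.elim hi hj
  · ext p
    have a1 := congrFun hxe (e p).1
    have a2 := congrFun hye (e p).2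
    simp only [Matrix.mulVec, dotProduct, Pi.smul_apply, smul_eq_mul] at a1 a2 ⊢
    rw [mul_mul_mul_comm, ← a1, ← a2, Finset.sum_mul_sum, ← Finset.sum_product',
      Finset.univ_product_univ, ← e.sum_comp]
    refine Finset.sum_congr rfl fun q _ => ?_
    rw [hK]; ring
end

section
/- Let G be a finite simple graph and let μ be the largest eigenvalue of the signless Laplacian A_G + D_G of G, where A_G is the adjacency matrix and D_G is the diagonal degree matrix. Then μ is the spectral radius of some finite simple graph, i.e., κ(μ) < ∞. -/
open Polynomial

lemma sl_hasEig {V : Type} [Fintype V] [DecidableEq V] (M : Matrix V V ℝ) (μ : ℝ) :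
    Module.End.HasEigenvalue (Matrix.toLin' M) μ ↔ ∃ x : V → ℝ, x ≠ 0 ∧ M.mulVec x = μ • x := by
  constructor
  · intro h
    obtain ⟨x, hx⟩ := h.exists_hasEigenvector
    refine ⟨x, hx.2, ?_⟩
    have := hx.apply_eq_smul
    simpa using this
  · rintro ⟨x, hx, h⟩
    refine Module.End.hasEigenvalue_of_hasEigenvector (x := x) ⟨?_, hx⟩
    rw [Module.End.mem_eigenspace_iff]
    simpa using h

lemma sl_bdd {V : Type} [Fintype V] [DecidableEq V] (M : Matrix V V ℝ) :
    BddAbove {μ : ℝ | Module.End.HasEigenvalue (Matrix.toLin' M) μ} := by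
  have : Set.Finite {μ : ℝ | Module.End.HasEigenvalue (Matrix.toLin' M) μ} :=
    Module.End.finite_hasEigenvalue (Matrix.toLin' M)
  exact this.bddAbove

lemma sl_nonneg {V : Type} [Fintype V] [DecidableEq V] (M : Matrix V V ℝ) (hM : M.IsHermitian)
    (ht : 0 ≤ M.trace) : 0 ≤ largestEig M := by
  unfold largestEig
  rcases isEmpty_or_nonempty V with hV | hV
  · apply Real.sSup_nonneg
    intro μ hμ
    obtain ⟨x, hx, -⟩ := (sl_hasEig M μ).1 hμ
    exact absurd (Subsingleton.elim _ _) hx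
  · by_contra hneg
    have h1 : ∀ i, hM.eigenvalues i < 0 := by
      intro i
      refine lt_of_le_of_lt (le_csSup (sl_bdd M) ?_) (not_le.1 hneg)
      refine (sl_hasEig M _).2 ⟨(hM.eigenvectorBasis i).ofLp, ?_, hM.mulVec_eigenvectorBasis i⟩
      intro h0
      have := hM.eigenvectorBasis.orthonormal.ne_zero i
      exact this (by ext j; simpa using congrFun h0 j)
    have h2 := hM.trace_eq_sum_eigenvalues
    have h3 : ∑ i, hM.eigenvalues i < 0 :=
      Finset.sum_neg (fun i _ => h1 i) Finset.univ_nonempty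
    simp at h2
    linarith

lemma sl_reindex {V W : Type} [Fintype V] [DecidableEq V] [Fintype W] [DecidableEq W]
    (e : W ≃ V) (M : Matrix V V ℝ) : largestEig (M.submatrix e e) = largestEig M := by
  unfold largestEig
  congr 1
  ext μ
  simp only [Set.mem_setOf_eq, sl_hasEig]
  constructor
  · rintro ⟨x, hx, h⟩
    refine ⟨x ∘ e.symm, ?_, ?_⟩
    · intro h0
      apply hx
      ext i
      simpa using congrFun h0 (e i)
    · ext i
      have := congrFun h (e.symm i)
      rw [Matrix.submatrix_mulVec_equiv] at this
      simpa using this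
  · rintro ⟨x, hx, h⟩
    refine ⟨x ∘ e, ?_, ?_⟩
    · intro h0
      apply hx
      ext i
      simpa using congrFun h0 (e.symm i)
    · ext i
      have := congrFun h (e i)
      rw [Matrix.submatrix_mulVec_equiv]
      simpa [Function.comp_assoc] using this

/-- Abstract spectral comparison. -/
lemma sl_core {V E : Type} [Fintype V] [DecidableEq V] [Fintype E] [DecidableEq E]
    (N : Matrix V E ℝ) (H : Matrix (E × Fin 3) (E × Fin 3) ℝ)
    (hH : ∀ p q, H p q = (if p.2 = q.2 then (N.transpose * N) p.1 q.1 else 0)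
      + (if p.1 = q.1 then 1 else 0) - (if p = q then 3 else 0))
    (hQ0 : 0 ≤ largestEig (N * N.transpose)) (hH0 : 0 ≤ largestEig H) :
    largestEig H = largestEig (N * N.transpose) := by
  have key : ∀ (y : E × Fin 3 → ℝ) (e : E) (i : Fin 3), H.mulVec y (e, i) =
      (N.transpose * N).mulVec (fun f => y (f, i)) e + ∑ j, y (e, j) - 3 * y (e, i) := by
    intro y e i
    simp only [Matrix.mulVec, dotProduct, hH, sub_mul, add_mul, Finset.sum_sub_distrib,
      Finset.sum_add_distrib]
    congr 1
    · congr 1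
      · rw [Fintype.sum_prod_type]
        simp
      · rw [Fintype.sum_prod_type, Finset.sum_comm]
        simp
    · simp
  have up : ∀ (ν : ℝ) (z : E → ℝ), z ≠ 0 → (N.transpose * N).mulVec z = ν • z →
      ν ≤ largestEig (N * N.transpose) := by
    intro ν z hz h
    by_cases hν : ν = 0
    · rw [hν]; exact hQ0
    · refine le_csSup (sl_bdd _) ((sl_hasEig _ _).2 ⟨N.mulVec z, ?_, ?_⟩)
      · intro h0
        rw [← Matrix.mulVec_mulVec, h0, Matrix.mulVec_zero] at h
        exact (smul_ne_zero hν hz) h.symm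
      · rw [← Matrix.mulVec_mulVec, Matrix.mulVec_mulVec (M := N.transpose), h,
          Matrix.mulVec_smul]
  apply le_antisymm
  · apply Real.sSup_le _ hQ0
    intro ν hν
    obtain ⟨y, hy, h⟩ := (sl_hasEig _ _).1 hν
    have h' : ∀ e i, (N.transpose * N).mulVec (fun f => y (f, i)) e + ∑ j, y (e, j)
        - 3 * y (e, i) = ν * y (e, i) := by
      intro e i
      rw [← key, h]; simp
    by_cases hz : (fun e => ∑ j, y (e, j)) = 0
    · have : ∃ i, (fun f => y (f, i)) ≠ 0 := by
        by_contra hc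
        push Not at hc
        apply hy
        ext ⟨e, i⟩
        exact congrFun (hc i) e
      obtain ⟨i, hi⟩ := this
      have := up (ν + 3) _ hi (by
        ext e
        have h1 := h' e i
        have h2 : ∑ j, y (e, j) = 0 := congrFun hz e
        rw [h2] at h1
        simp only [Pi.smul_apply, smul_eq_mul]
        linarith)
      linarith
    · apply up ν _ hz
      ext e
      have hs : (fun e => ∑ j, y (e, j)) = ∑ j, (fun e => y (e, j)) := by
        ext e; simp
      have h0 := h' e 0
      have h1 := h' e 1
      have h2 := h' e 2
      rw [hs, Matrix.mulVec_sum]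
      simp only [Fin.sum_univ_three, Pi.add_apply, Pi.smul_apply, smul_eq_mul] at *
      linarith
  · apply Real.sSup_le _ hH0
    intro ν hν
    obtain ⟨x, hx, h⟩ := (sl_hasEig _ _).1 hν
    by_cases hν0 : ν = 0
    · rw [hν0]; exact hH0
    · refine le_csSup (sl_bdd _) ((sl_hasEig _ _).2 ⟨fun p => N.transpose.mulVec x p.1, ?_, ?_⟩)
      · intro h0
        have h1 : N.transpose.mulVec x = 0 := by
          ext e; exact congrFun h0 (e, 0)
        rw [← Matrix.mulVec_mulVec, h1, Matrix.mulVec_zero] at h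
        exact (smul_ne_zero hν0 hx) h.symm
      · ext ⟨e, i⟩
        rw [key]
        have : (N.transpose * N).mulVec (N.transpose.mulVec x) = ν • N.transpose.mulVec x := by
          rw [← Matrix.mulVec_mulVec, Matrix.mulVec_mulVec (M := N), h, Matrix.mulVec_smul]
        have h2 := congrFun this e
        simp only [Pi.smul_apply, smul_eq_mul] at h2
        change (N.transpose * N).mulVec (N.transpose.mulVec x) e + _ - _ = _
        rw [h2]
        simp

lemma sl_count {n : ℕ} (G : SimpleGraph (Fin n)) (e f : Sym2 (Fin n))
    (he : e ∈ G.edgeSet) (hf : f ∈ G.edgeSet) :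
    (∑ v : Fin n, (if v ∈ e then (1 : ℝ) else 0) * (if v ∈ f then 1 else 0)) =
      if e = f then 2 else if ∃ v, v ∈ e ∧ v ∈ f then 1 else 0 := by
  classical
  have h1 : (∑ v : Fin n, (if v ∈ e then (1 : ℝ) else 0) * (if v ∈ f then 1 else 0)) =
      ((Finset.univ.filter fun v => v ∈ e ∧ v ∈ f).card : ℝ) := by
    rw [Finset.card_filter]
    push_cast
    refine Finset.sum_congr rfl fun v _ => ?_
    by_cases a : v ∈ e <;> by_cases b : v ∈ f <;> simp [a, b]
  rw [h1]
  split_ifs with hef hv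
  · subst hef
    induction e with
    | _ a b =>
      have hab : a ≠ b := G.ne_of_adj he
      have : (Finset.univ.filter fun v => v ∈ s(a, b) ∧ v ∈ s(a, b)) = {a, b} := by
        ext v; simp
      rw [this, Finset.card_pair hab]
      norm_num
  · obtain ⟨v, hve, hvf⟩ := hv
    have : (Finset.univ.filter fun v => v ∈ e ∧ v ∈ f) = {v} := by
      ext w
      simp only [Finset.mem_filter, Finset.mem_univ, true_and, Finset.mem_singleton]
      constructor
      · rintro ⟨a, b⟩
        by_contra hne
        exact hef (((Sym2.mem_and_mem_iff hne).1 ⟨a, hve⟩).trans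
          ((Sym2.mem_and_mem_iff hne).1 ⟨b, hvf⟩).symm)
      · rintro rfl; exact ⟨hve, hvf⟩
    rw [this]; simp
  · have : (Finset.univ.filter fun v => v ∈ e ∧ v ∈ f) = ∅ := by
      ext w
      simp only [Finset.mem_filter, Finset.mem_univ, true_and, Finset.notMem_empty, iff_false]
      exact fun h => hv ⟨w, h⟩
    rw [this]; simp

/-- line graph times triangle -/
def slGraph {n : ℕ} (G : SimpleGraph (Fin n)) : SimpleGraph (G.edgeSet × Fin 3) where
  Adj p q := (p.2 = q.2 ∧ p.1 ≠ q.1 ∧ ∃ v, v ∈ p.1.1 ∧ v ∈ q.1.1) ∨ (p.1 = q.1 ∧ p.2 ≠ q.2)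
  symm := ⟨by
    rintro p q (⟨h1, h2, v, h3, h4⟩ | ⟨h1, h2⟩)
    · exact Or.inl ⟨h1.symm, h2.symm, v, h4, h3⟩
    · exact Or.inr ⟨h1.symm, h2.symm⟩⟩
  loopless := ⟨by
    rintro p (⟨h1, h2, _⟩ | ⟨h1, h2⟩)
    · exact h2 rfl
    · exact h2 rfl⟩

/-- The largest eigenvalue `μ` of the signless Laplacian `A_G + D_G` of a finite simple
graph `G` has finite spectral radius order. -/
theorem kappa_signlessLaplacian_lt_top (n : ℕ) (G : SimpleGraph (Fin n)) (μ : ℝ)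
    (hμ : μ = (letI := Classical.decRel G.Adj;
      largestEig (G.adjMatrix ℝ + Matrix.diagonal fun v => (G.degree v : ℝ)))) :
    kappa μ < ⊤ := by
  classical
  let N : Matrix (Fin n) G.edgeSet ℝ := Matrix.of fun v e => if v ∈ e.1 then 1 else 0
  have hN : ∀ v e, N v e = if v ∈ e.1 then 1 else 0 := fun _ _ => rfl
  have hinc : ∀ v e, N v e = G.incMatrix ℝ v e.1 := by
    intro v e
    rw [hN, SimpleGraph.incMatrix_apply']
    simp [SimpleGraph.incidenceSet, e.2]
  have hNN : N * N.transpose = G.incMatrix ℝ * (G.incMatrix ℝ).transpose := by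
    ext v w
    simp only [Matrix.mul_apply, Matrix.transpose_apply, hinc]
    have := Finset.sum_subtype_of_mem (s := G.edgeFinset) (p := fun e => e ∈ G.edgeSet)
      (fun e => G.incMatrix ℝ v e * G.incMatrix ℝ w e) (fun e he => by simpa using he)
    rw [← Finset.sum_subset (Finset.subset_univ G.edgeFinset), ← this]
    · refine Finset.sum_congr ?_ fun _ _ => rfl
      ext e; simp
    · intro e _ he
      rw [SimpleGraph.incMatrix_of_notMem_incidenceSet, zero_mul]
      intro h
      exact he (by simpa using h.1)
  have hQ : μ = largestEig (N * N.transpose) := by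
    rw [hμ, hNN, SimpleGraph.incMatrix_mul_transpose]
    congr 1
    ext v w
    by_cases h : v = w
    · subst h
      simp
      try congr!
    · simp [h, SimpleGraph.adjMatrix_apply]
  have hB : ∀ e f : G.edgeSet, (N.transpose * N) e f =
      if e = f then 2 else if ∃ v, v ∈ e.1 ∧ v ∈ f.1 then 1 else 0 := by
    intro e f
    have := sl_count G e.1 f.1 e.2 f.2
    simp only [Matrix.mul_apply, Matrix.transpose_apply, hN]
    rw [this]
    simp [Subtype.ext_iff]
  have hmain : largestEig ((slGraph G).adjMatrix ℝ) = μ := by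
    rw [hQ]
    apply sl_core
    · rintro ⟨e, i⟩ ⟨f, j⟩
      rw [SimpleGraph.adjMatrix_apply, hB]
      by_cases h1 : e = f <;> by_cases h2 : i = j <;> simp [slGraph, h1, h2]
      norm_num
    · apply sl_nonneg
      · simpa using Matrix.isHermitian_mul_conjTranspose_self N
      · refine Finset.sum_nonneg fun v _ => ?_
        simp only [Matrix.diag_apply, Matrix.mul_apply, Matrix.transpose_apply]
        exact Finset.sum_nonneg fun e _ => mul_self_nonneg _
    · apply sl_nonneg
      · exact SimpleGraph.isSymm_adjMatrix _
      · simp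
  let e := (Fintype.equivFin (G.edgeSet × Fin 3)).symm
  refine lt_of_le_of_lt (sInf_le ⟨_, rfl, (slGraph G).comap e, ?_⟩) (WithTop.coe_lt_top _)
  rw [← hmain, ← sl_reindex e]
  unfold specRad
  congr 1
end

section
/- Let a and b be real numbers with √(2+√5) ≤ a < b. Then sup{κ(λ) : λ ∈ (a,b) and κ(λ) < ∞} = +∞; that is, for every positive integer M there exists λ ∈ (a,b) which is the spectral radius of some finite simple graph and satisfies κ(λ) > M. -/
open Polynomial

lemma greedy_exists (lam q : ℝ) (hq : 1 < q) (hl : lam = q + 1/q) :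
    ∃ (r : ℕ → ℕ) (w s x : ℕ → ℝ), w 0 = q ∧ (∀ i, 0 ≤ s i) ∧ (∀ i, s i * lam < 1) ∧
      (∀ i, w i = s i + r i / lam) ∧ (∀ i, w (i+1) = q^2 * s i / (1 + q * s i)) ∧
      x 0 = 1 ∧ (∀ i, x (i+1) = (1/q + s i) * x i) := by
  have hlam : 0 < lam := by rw [hl]; positivity
  let sf : ℝ → ℝ := fun w => w - (⌊lam * w⌋₊ : ℝ) / lam
  let w : ℕ → ℝ := fun n => Nat.rec q (fun _ w => q^2 * sf w / (1 + q * sf w)) n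
  let x : ℕ → ℝ := fun n => Nat.rec 1 (fun i y => (1/q + sf (w i)) * y) n
  have hsf : ∀ v, 0 ≤ v → 0 ≤ sf v := by
    intro v hv
    have := Nat.floor_le (a := lam * v) (by positivity)
    have h2 : (⌊lam * v⌋₊ : ℝ) / lam ≤ v := by rw [div_le_iff₀ hlam]; linarith
    simp only [sf]; linarith
  have hw : ∀ i, 0 ≤ w i := by
    intro i
    induction i with
    | zero => show 0 ≤ q; linarith
    | succ k ih =>
      show 0 ≤ q^2 * sf (w k) / (1 + q * sf (w k))
      have := hsf _ ih
      positivity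
  refine ⟨fun i => ⌊lam * w i⌋₊, w, fun i => sf (w i), x, rfl, fun i => hsf _ (hw i), ?_, ?_, fun i => rfl, rfl, fun i => rfl⟩
  · intro i
    have := Nat.lt_floor_add_one (lam * w i)
    have h2 : (w i - (⌊lam * w i⌋₊ : ℝ) / lam) * lam = lam * w i - ⌊lam * w i⌋₊ := by
      field_simp
    show (w i - (⌊lam * w i⌋₊ : ℝ) / lam) * lam < 1
    rw [h2]; linarith
  · intro i
    show w i = (w i - (⌊lam * w i⌋₊ : ℝ) / lam) + _
    ring

lemma greedy_small (lam q : ℝ) (hq : 1 < q) (hl : lam = q + 1/q) (hz : 0 < q^4 - q^2 - 1)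
    (r : ℕ → ℕ) (w s x : ℕ → ℝ) (hs0 : ∀ i, 0 ≤ s i) (hs1 : ∀ i, s i * lam < 1)
    (hw : ∀ i, w i = s i + r i / lam) (hws : ∀ i, w (i+1) = q^2 * s i / (1 + q * s i))
    (hx : ∀ i, x (i+1) = (1/q + s i) * x i) (ε : ℝ) (hε : 0 < ε) :
    ∃ n, s n * x n ^ 2 < ε := by
  have hq0 : 0 < q := by linarith
  have hlam : 0 < lam := by rw [hl]; positivity
  have hlq : lam * q = q^2 + 1 := by rw [hl]; field_simp
  by_contra! hcon
  set D := q - 1/q with hD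
  have hDq : D * q = q^2 - 1 := by rw [hD]; field_simp
  -- constants
  have hDl : 1 < D * lam := by
    have : D * lam * q^2 = q^4 - 1 := by
      calc D * lam * q^2 = (D*q)*(lam*q) := by ring
        _ = _ := by rw [hDq, hlq]; ring
    have h3 : 1 * q^2 < D * lam * q^2 := by rw [this]; linarith
    exact lt_of_mul_lt_mul_right h3 (by positivity)
  have hx2 : ∀ i, ε * lam ≤ x i ^ 2 := by
    intro i
    have h1 := hcon i
    have h2 : ε * lam ≤ (s i * lam) * x i ^ 2 := by nlinarith
    nlinarith [hs1 i, sq_nonneg (x i)]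
  have hspos : ∀ i, 0 < s i := by
    intro i
    rcases (hs0 i).lt_or_eq with h | h
    · exact h
    · have := hcon i; rw [← h] at this; linarith
  let E : ℕ → ℝ := fun i => x i ^ 2 * (s i * (D - s i))
  have hsD : ∀ i, s i < D := by
    intro i
    have : s i * lam < D * lam := (hs1 i).trans hDl
    exact lt_of_mul_lt_mul_right this hlam.le
  have hE0 : ∀ i, 0 ≤ E i := by
    intro i
    have := hs0 i; have := hsD i
    have : 0 ≤ D - s i := by linarith
    simp only [E]; positivity
  have hEw : ∀ i, x (i+1) ^ 2 * (w (i+1) * (D - w (i+1))) = E i := by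
    intro i
    have h1 : 0 < 1 + q * s i := by have := hs0 i; positivity
    simp only [E]
    rw [hx, hws, hD]
    field_simp
    ring
  let c0 : ℝ := D + 1/lam - 2 * (q^2/(lam+q))
  have hc0 : 0 < c0 := by
    have : c0 = (q^4 - q^2 - 1) / (q * (q^2+1) * (2*q^2+1)) := by
      simp only [c0]; rw [hD, hl]; field_simp; ring
    rw [this]; positivity
  have hwW : ∀ i, w (i+1) ≤ q^2/(lam+q) := by
    intro i
    rw [hws]
    have := hs0 i
    rw [div_le_div_iff₀ (by positivity) (by positivity)]
    nlinarith [hs1 i, sq_nonneg q, mul_pos hq0 hq0]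
  have hdiff : ∀ i, E i - E (i+1) = x (i+1)^2 * ((r (i+1) / lam) * (D - w (i+1) - s (i+1))) := by
    intro i
    rw [← hEw i]
    simp only [E]
    have := hw (i+1)
    rw [this]; ring
  have hreset : ∀ i, r (i+1) ≠ 0 → ε * c0 ≤ E i - E (i+1) := by
    intro i hr
    have hr1 : (1:ℝ) ≤ r (i+1) := by exact_mod_cast Nat.one_le_iff_ne_zero.mpr hr
    rw [hdiff]
    have h1 : 1/lam ≤ r (i+1) / lam := by gcongr
    have h2 : c0 ≤ D - w (i+1) - s (i+1) := by
      have := hwW i; have := hw (i+1)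
      simp only [c0]; linarith
    calc ε * c0 = (ε * lam) * ((1/lam) * c0) := by field_simp
      _ ≤ _ := by
        have := hx2 (i+1)
        gcongr
  have hanti : ∀ i, E (i+1) ≤ E i := by
    intro i
    by_cases hr : r (i+1) = 0
    · have := hdiff i
      rw [hr] at this; simp at this; linarith
    · have := hreset i hr
      have : 0 < ε * c0 := by positivity
      linarith
  have hA : Antitone E := antitone_nat_of_succ_le hanti
  have hconv : Filter.Tendsto E Filter.atTop (nhds (⨅ i, E i)) :=
    tendsto_atTop_ciInf hA ⟨0, by rintro _ ⟨i, rfl⟩; exact hE0 i⟩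
  have hconv2 := hconv.sub (hconv.comp (Filter.tendsto_add_atTop_nat 1))
  rw [sub_self] at hconv2
  have hev := hconv2.eventually (gt_mem_nhds (show (0:ℝ) < ε * c0 by positivity))
  obtain ⟨N, hN⟩ := Filter.eventually_atTop.mp hev
  have hr0 : ∀ i ≥ N, r (i+1) = 0 := by
    intro i hi
    by_contra hr
    have h1 := hreset i hr
    have h2 := hN i hi
    simp only [Function.comp] at h2
    linarith
  let ρ : ℝ := q^2 * lam / (lam + q)
  have hρ : 1 < ρ := by
    simp only [ρ]
    rw [lt_div_iff₀ (by positivity)]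
    have : (1 * (lam + q)) * q < (q^2 * lam) * q := by nlinarith
    exact lt_of_mul_lt_mul_right this hq0.le
  have hgrow : ∀ i ≥ N, ρ * s i ≤ s (i+1) := by
    intro i hi
    have h1 := hw (i+1)
    rw [hr0 i hi] at h1
    simp at h1
    rw [← h1, hws]
    simp only [ρ]
    have := hs0 i
    rw [div_mul_eq_mul_div, div_le_div_iff₀ (by positivity) (by positivity)]
    have : 0 ≤ q^2 * s i * (q * (1 - s i * lam)) := by
      have := hs1 i
      have : 0 ≤ 1 - s i * lam := by linarith
      positivity
    nlinarith
  have hgeo : ∀ k, ρ^k * s N ≤ s (N+k) := by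
    intro k
    induction k with
    | zero => simp
    | succ k ih =>
      have := hgrow (N+k) (by omega)
      calc ρ^(k+1) * s N = ρ * (ρ^k * s N) := by ring
        _ ≤ ρ * s (N+k) := by gcongr
        _ ≤ _ := this
  obtain ⟨k, hk⟩ := pow_unbounded_of_one_lt (D / s N) hρ
  rw [div_lt_iff₀ (hspos N)] at hk
  linarith [hgeo k, hsD (N+k)]

lemma largestEig_bounds {V : Type} [Fintype V] [DecidableEq V] (A : Matrix V V ℝ)
    (hsymm : A.IsHermitian) (hnn : ∀ i j, 0 ≤ A i j) (lam err : ℝ) (y e : V → ℝ)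
    (hy : ∀ v, 0 < y v) (he : ∀ v, 0 ≤ e v) (hne : Nonempty V)
    (hAy : ∀ v, ∑ w, A v w * y w = lam * y v - e v)
    (herr : ∑ v, e v * y v ≤ err * ∑ v, y v ^ 2) :
    lam - err ≤ largestEig A ∧ largestEig A ≤ lam := by
  have hub : ∀ μ : ℝ, Module.End.HasEigenvalue (Matrix.toLin' A) μ → μ ≤ lam := by
    intro μ hμ
    obtain ⟨z, hz⟩ := hμ.exists_hasEigenvector
    have hzz : ∀ v, ∑ w, A v w * z w = μ * z v := by
      intro v
      have := congrFun hz.apply_eq_smul v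
      simpa [Matrix.toLin'_apply, Matrix.mulVec, dotProduct] using this
    obtain ⟨v, -, hv⟩ := Finset.exists_max_image Finset.univ (fun v => |z v| / y v) Finset.univ_nonempty
    set C := |z v| / y v with hC
    have hC2 : ∀ w, |z w| ≤ C * y w := by
      intro w
      have := hv w (Finset.mem_univ w)
      rwa [div_le_iff₀ (hy w)] at this
    have hCv : |z v| = C * y v := by rw [hC]; field_simp [(hy v).ne']
    have hC0 : 0 ≤ C := div_nonneg (abs_nonneg _) (hy v).le
    have hCpos : 0 < C := by
      rcases hC0.lt_or_eq with h | h
      · exact h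
      · exfalso
        apply hz.2
        funext w
        have := hC2 w
        rw [← h, zero_mul] at this
        exact abs_nonpos_iff.mp this
    have h1 : μ * (C * y v) ≤ lam * (C * y v) := by
      calc μ * (C * y v) = μ * |z v| := by rw [hCv]
        _ ≤ |μ| * |z v| := by gcongr; exact le_abs_self μ
        _ = |∑ w, A v w * z w| := by rw [hzz, abs_mul]
        _ ≤ ∑ w, |A v w * z w| := Finset.abs_sum_le_sum_abs _ _
        _ ≤ ∑ w, A v w * (C * y w) := by
          apply Finset.sum_le_sum
          intro w _
          rw [abs_mul, abs_of_nonneg (hnn v w)]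
          exact mul_le_mul_of_nonneg_left (hC2 w) (hnn v w)
        _ = C * ∑ w, A v w * y w := by
          rw [Finset.mul_sum]; apply Finset.sum_congr rfl; intros; ring
        _ ≤ _ := by
          rw [hAy]
          have := mul_nonneg hC0 (he v)
          nlinarith
    exact le_of_mul_le_mul_right h1 (mul_pos hCpos (hy v))
  have hlow : ∃ μ : ℝ, Module.End.HasEigenvalue (Matrix.toLin' A) μ ∧ lam - err ≤ μ := by
    have hB : ((lam - err) • (1 : Matrix V V ℝ) - A).IsHermitian := by
      apply Matrix.IsHermitian.sub _ hsymm
      ext i j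
      simp [Matrix.one_apply, eq_comm]
    by_cases hpd : ((lam - err) • (1 : Matrix V V ℝ) - A).PosDef
    · exfalso
      have hy0 : y ≠ 0 := by
        intro h
        obtain ⟨v⟩ := hne
        have := hy v
        rw [h] at this
        simp at this
      have h1 := hpd.dotProduct_mulVec_pos hy0
      rw [Matrix.sub_mulVec, Matrix.smul_mulVec, Matrix.one_mulVec] at h1
      have h2 : star y ⬝ᵥ ((lam - err) • y - A.mulVec y) =
          ∑ v, e v * y v - err * ∑ v, y v ^ 2 := by
        rw [Finset.mul_sum, ← Finset.sum_sub_distrib]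
        simp only [dotProduct]
        apply Finset.sum_congr rfl
        intro v _
        have h3 : A.mulVec y v = lam * y v - e v := hAy v
        simp only [Pi.sub_apply, Pi.smul_apply, smul_eq_mul, h3, Pi.star_apply, star_trivial]
        ring
      rw [h2] at h1
      linarith
    · rw [hB.posDef_iff_eigenvalues_pos] at hpd
      push Not at hpd
      obtain ⟨i, hi⟩ := hpd
      refine ⟨lam - err - hB.eigenvalues i, ?_, by linarith⟩
      apply Module.End.hasEigenvalue_of_hasEigenvector (x := (hB.eigenvectorBasis i).ofLp)
      rw [Module.End.hasEigenvector_iff, Module.End.mem_eigenspace_iff]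
      constructor
      · have := hB.mulVec_eigenvectorBasis i
        rw [Matrix.sub_mulVec, Matrix.smul_mulVec, Matrix.one_mulVec] at this
        rw [Matrix.toLin'_apply]
        generalize (hB.eigenvectorBasis i).ofLp = u at this ⊢
        generalize hB.eigenvalues i = β at this ⊢
        rw [sub_smul, ← this]
        abel
      · intro h
        apply (hB.eigenvectorBasis.orthonormal.ne_zero i)
        ext j
        exact congrFun h j
  obtain ⟨μ, hμ, hμ2⟩ := hlow
  constructor
  · exact hμ2.trans (le_csSup ⟨lam, fun x hx => hub x hx⟩ hμ)
  · exact csSup_le ⟨μ, hμ⟩ hub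

lemma my_ite {P Q : Prop} {dP : Decidable P} {dQ : Decidable Q} (h : P ↔ Q) :
    (if P then (1:ℝ) else 0) = if Q then 1 else 0 := by
  by_cases hP : P
  · rw [if_pos hP, if_pos (h.mp hP)]
  · rw [if_neg hP, if_neg (fun hQ => hP (h.mpr hQ))]

lemma specRad_transfer {V : Type} [Fintype V] [DecidableEq V] (G : SimpleGraph V) :
    ∃ G' : SimpleGraph (Fin (Fintype.card V)), specRad G' = specRad G := by
  let e := Fintype.equivFin V
  refine ⟨G.comap e.symm, ?_⟩
  unfold specRad largestEig
  congr 1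
  ext μ
  simp only [Set.mem_ofPred_eq, Module.End.hasEigenvalue_iff_isRoot_charpoly, Matrix.charpoly_toLin']
  rw [← Matrix.charpoly_reindex e]
  have : @SimpleGraph.adjMatrix ℝ _ (G.comap e.symm) (Classical.decRel _) _ _ =
    Matrix.reindex e e (@SimpleGraph.adjMatrix ℝ _ G (Classical.decRel _) _ _) := by
    ext i j
    simp only [SimpleGraph.adjMatrix_apply, Matrix.reindex_apply, Matrix.submatrix_apply]
    exact my_ite Iff.rfl
  rw [this]

/-- Caterpillar adjacency. -/
def catAdj (N : ℕ) (r : ℕ → ℕ) :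
    (Fin N ⊕ (Σ i : Fin N, Fin (r i))) → (Fin N ⊕ (Σ i : Fin N, Fin (r i))) → Prop
  | Sum.inl i, Sum.inl j => (i : ℕ) + 1 = j ∨ (j : ℕ) + 1 = i
  | Sum.inl i, Sum.inr p => i = p.1
  | Sum.inr p, Sum.inl i => i = p.1
  | Sum.inr _, Sum.inr _ => False

/-- Caterpillar graph. -/
def cat (N : ℕ) (r : ℕ → ℕ) : SimpleGraph (Fin N ⊕ (Σ i : Fin N, Fin (r i))) where
  Adj := catAdj N r
  symm := ⟨by
    rintro (i | p) (j | p') h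
    · exact Or.symm h
    · exact h
    · exact h
    · exact h⟩
  loopless := ⟨by
    rintro (i | p) h
    · simp [catAdj] at h
    · exact h⟩

lemma spine_sum (N : ℕ) (Y : ℕ → ℝ) (hY : Y 0 = 0) (i : ℕ) (hi : i < N) :
    ∑ j : Fin N, (if i + 1 = (j : ℕ) ∨ (j : ℕ) + 1 = i then (1:ℝ) else 0) * Y (j + 1) =
      Y i + if i + 1 < N then Y (i + 2) else 0 := by
  rw [Fin.sum_univ_eq_sum_range
    (fun j => (if i + 1 = j ∨ j + 1 = i then (1:ℝ) else 0) * Y (j + 1)) N]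
  have h1 : ∀ j ∈ Finset.range N, (if i + 1 = j ∨ j + 1 = i then (1:ℝ) else 0) * Y (j + 1) =
      (if j + 1 = i then Y i else 0) + (if i + 1 = j then Y (i+2) else 0) := by
    intro j _
    by_cases ha : i + 1 = j
    · have hb : ¬ (j + 1 = i) := by omega
      subst ha
      simp [hb]
    · by_cases hb : j + 1 = i
      · simp [hb]
        intro h; omega
      · simp [ha, hb]
  rw [Finset.sum_congr rfl h1, Finset.sum_add_distrib]
  congr 1
  · cases i with
    | zero => simp [hY]
    | succ k =>
      simp
      intro h; omega
  · simp

lemma cat_bounds (N : ℕ) (hN : 0 < N) (r : ℕ → ℕ) (lam err : ℝ) (hlam : 0 < lam)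
    (herr0 : 0 ≤ err) (Y d : ℕ → ℝ)
    (hY0 : Y 0 = 0) (hY1 : Y 1 = 1) (hpos : ∀ i, 0 < Y (i + 1)) (hd : ∀ i, 0 ≤ d i)
    (hrec : ∀ i, lam * Y (i+1) = Y i + Y (i+2) + r i / lam * Y (i+1) + d i)
    (herr : ∑ i ∈ Finset.range N, d i * Y (i+1) + Y (N+1) * Y N ≤ err) :
    lam - err ≤ specRad (cat N r) ∧ specRad (cat N r) ≤ lam := by
  unfold specRad
  let y : (Fin N ⊕ (Σ i : Fin N, Fin (r i))) → ℝ :=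
    Sum.elim (fun i => Y (i+1)) (fun p => Y (p.1 + 1) / lam)
  let e : (Fin N ⊕ (Σ i : Fin N, Fin (r i))) → ℝ :=
    Sum.elim (fun i => d i + if (i:ℕ) + 1 < N then 0 else Y (i+2)) (fun p => 0)
  have hll : ∀ i j : Fin N, @SimpleGraph.adjMatrix ℝ _ (cat N r) (Classical.decRel _) _ _
      (Sum.inl i) (Sum.inl j) = if (i:ℕ) + 1 = (j:ℕ) ∨ (j:ℕ) + 1 = (i:ℕ) then (1:ℝ) else 0 := by
    intro i j
    rw [SimpleGraph.adjMatrix_apply]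
    exact my_ite Iff.rfl
  have hlr : ∀ (i : Fin N) p, @SimpleGraph.adjMatrix ℝ _ (cat N r) (Classical.decRel _) _ _
      (Sum.inl i) (Sum.inr p) = if i = p.1 then (1:ℝ) else 0 := by
    intro i p
    rw [SimpleGraph.adjMatrix_apply]
    exact my_ite Iff.rfl
  have hrl : ∀ (i : Fin N) p, @SimpleGraph.adjMatrix ℝ _ (cat N r) (Classical.decRel _) _ _
      (Sum.inr p) (Sum.inl i) = if i = p.1 then (1:ℝ) else 0 := by
    intro i p
    rw [SimpleGraph.adjMatrix_apply]
    exact my_ite Iff.rfl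
  have hrr : ∀ p p', @SimpleGraph.adjMatrix ℝ _ (cat N r) (Classical.decRel _) _ _
      (Sum.inr p) (Sum.inr p') = (0:ℝ) := by
    intro p p'
    rw [SimpleGraph.adjMatrix_apply]
    exact if_neg (fun h => h)
  apply largestEig_bounds _ _ _ lam err y e
  · rintro (i | p)
    · exact hpos i
    · exact div_pos (hpos _) hlam
  · rintro (i | p)
    · have := hd i; have := hpos (i+1)
      simp only [e, Sum.elim_inl]
      split_ifs <;> linarith
    · simp [e]
  · exact ⟨Sum.inl ⟨0, hN⟩⟩
  · rintro (i | p)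
    · rw [Fintype.sum_sum_type, Fintype.sum_sigma]
      simp only [hll, hlr, hrl, hrr, y, e, Sum.elim_inl, Sum.elim_inr]
      rw [spine_sum N Y hY0 i i.2]
      have := hrec i
      have h2 : ∑ x : Fin N, ∑ _z : Fin (r x), (if i = x then (1:ℝ) else 0) * (Y (x + 1) / lam) =
        r i / lam * Y (i+1) := by
        simp
        ring
      rw [h2]
      split_ifs <;> linarith
    · rw [Fintype.sum_sum_type, Fintype.sum_sigma]
      simp only [hll, hlr, hrl, hrr, y, e, Sum.elim_inl, Sum.elim_inr]
      simp
      field_simp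
  · have h1 : ∑ v, e v * y v ≤ err := by
      refine le_trans (le_of_eq ?_) herr
      rw [Fintype.sum_sum_type]
      simp only [y, e, Sum.elim_inl, Sum.elim_inr, zero_mul, Finset.sum_const_zero, add_zero]
      rw [Fin.sum_univ_eq_sum_range (fun i => (d i + if i + 1 < N then 0 else Y (i+2)) * Y (i+1)) N]
      simp only [add_mul, Finset.sum_add_distrib]
      congr 1
      obtain ⟨k, rfl⟩ : ∃ k, N = k + 1 := ⟨N - 1, by omega⟩
      rw [Finset.sum_range_succ, Finset.sum_eq_zero]
      · simp
      · intro i hi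
        have := Finset.mem_range.mp hi
        simp [this]
    have h2 : 1 ≤ ∑ v, y v ^ 2 := by
      have := Finset.single_le_sum (f := fun v => y v ^ 2) (fun v _ => sq_nonneg _)
        (Finset.mem_univ (Sum.inl ⟨0, hN⟩))
      simpa [y, hY1] using this
    nlinarith
  · ext i j
    simp only [Matrix.conjTranspose_apply, SimpleGraph.adjMatrix_apply, star_trivial]
    exact my_ite (SimpleGraph.adj_comm _ _ _)
  · intro i j
    rw [SimpleGraph.adjMatrix_apply]
    split_ifs <;> norm_num

lemma density (lam : ℝ) (h : Real.sqrt (2 + Real.sqrt 5) < lam) (ε : ℝ) (hε : 0 < ε) :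
    ∃ (N : ℕ) (r : ℕ → ℕ), lam - ε ≤ specRad (cat N r) ∧ specRad (cat N r) ≤ lam := by
  have hlam0 : 0 < lam := lt_of_le_of_lt (Real.sqrt_nonneg _) h
  have h5 : (2:ℝ) < Real.sqrt 5 := by
    rw [Real.lt_sqrt (by norm_num)]; norm_num
  have hl2 : 2 + Real.sqrt 5 < lam ^ 2 := by
    rwa [Real.sqrt_lt' hlam0] at h
  obtain ⟨q, hq, hl⟩ : ∃ q : ℝ, 1 < q ∧ lam = q + 1/q := by
    have hpos : 0 < lam^2 - 4 := by linarith
    have hs := Real.sq_sqrt hpos.le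
    have hs0 := Real.sqrt_pos.mpr hpos
    set t := Real.sqrt (lam^2 - 4)
    have h2 : 2 < lam := by nlinarith
    refine ⟨(lam + t)/2, by linarith, ?_⟩
    have : 0 < lam + t := by linarith
    field_simp
    nlinarith
  have hq0 : 0 < q := by linarith
  have hz : 0 < q^4 - q^2 - 1 := by
    have h1 : 1 < q^2 := by nlinarith
    have h2 : lam^2 = q^2 + 2 + 1/q^2 := by rw [hl]; field_simp; ring
    have h3 : Real.sqrt 5 < q^2 + 1/q^2 := by linarith
    have h4 : 5 < (q^2 + 1/q^2)^2 := by
      have := Real.sq_sqrt (show (0:ℝ) ≤ 5 by norm_num)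
      nlinarith
    have h5 : 1 < (q^2 - 1/q^2)^2 := by
      have : (q^2 - 1/q^2)^2 = (q^2 + 1/q^2)^2 - 4 := by field_simp; ring
      linarith
    have h6 : 0 < q^2 - 1/q^2 := by
      have : 1/q^2 < 1 := by rw [div_lt_one (by positivity)]; exact h1
      linarith
    have h7 : 1 < q^2 - 1/q^2 := by nlinarith
    have h8 : q^4 - q^2 - 1 = q^2 * (q^2 - 1/q^2 - 1) := by field_simp; ring
    rw [h8]
    apply mul_pos (by positivity); linarith
  obtain ⟨r, w, s, x, hw0, hs0, hs1, hw, hws, hx0, hx⟩ := greedy_exists lam q hq hl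
  obtain ⟨n, hn⟩ := greedy_small lam q hq hl hz r w s x hs0 hs1 hw hws hx (ε/2) (by linarith)
  let s' : ℕ → ℝ := fun i => if i < n then s i else 0
  let r' : ℕ → ℕ := fun i => if i ≤ n then r i else 0
  let d : ℕ → ℝ := fun i => if i = n then s n * x n else 0
  let y : ℕ → ℝ := fun m => Nat.rec 1 (fun i v => (1/q + s' i) * v) m
  have hy0 : y 0 = 1 := rfl
  have hy : ∀ i, y (i+1) = (1/q + s' i) * y i := fun i => rfl
  have hs'0 : ∀ i, 0 ≤ s' i := by
    intro i; simp only [s']; split_ifs; exacts [hs0 i, le_rfl]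
  have hypos : ∀ i, 0 < y i := by
    intro i
    induction i with
    | zero => rw [hy0]; norm_num
    | succ k ih => rw [hy]; have := hs'0 k; positivity
  have hyx : ∀ i ≤ n, y i = x i := by
    intro i
    induction i with
    | zero => intro _; rw [hy0, hx0]
    | succ k ih =>
      intro hk
      rw [hy, hx, ih (by omega)]
      simp only [s']
      rw [if_pos (by omega)]
  have hytail : ∀ k, y (n+k) = x n * (1/q)^k := by
    intro k
    induction k with
    | zero => simp [hyx n le_rfl]
    | succ k ih =>
      rw [← add_assoc, hy, ih]
      simp only [s']
      rw [if_neg (by omega)]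
      ring
  have hxn : 0 < x n := by rw [← hyx n le_rfl]; exact hypos n
  obtain ⟨K, hK⟩ := exists_pow_lt_of_lt_one (show 0 < ε/2 / (x n)^2 by positivity)
    (show 1/q < 1 by rw [div_lt_one hq0]; exact hq)
  rw [lt_div_iff₀ (by positivity)] at hK
  let Y : ℕ → ℝ := fun m => Nat.casesOn m 0 y
  have hY : ∀ i, Y (i+1) = y i := fun i => rfl
  have hY0 : Y 0 = 0 := rfl
  refine ⟨n + 1 + K, r', cat_bounds _ (by omega) r' lam ε hlam0 hε.le Y d hY0 rfl
    (fun i => hypos i) ?_ ?_ ?_⟩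
  · intro i
    simp only [d]
    split_ifs
    · exact mul_nonneg (hs0 n) hxn.le
    · exact le_rfl
  · intro i
    have hkey : s' i * y i + r' i / lam * y i + d i =
        (match i with | 0 => q | j+1 => q^2 * s' j / (1 + q * s' j)) * y i := by
      have hcore : i ≤ n → s' i * y i + r' i / lam * y i + d i = w i * y i := by
        intro hi
        rw [hw i]
        simp only [s', r', d]
        rw [if_pos hi]
        rcases hi.lt_or_eq with hlt | heq
        · rw [if_pos hlt, if_neg hlt.ne]; ring
        · subst heq
          rw [if_neg (lt_irrefl _), if_pos rfl, hyx i le_rfl]; ring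
      cases i with
      | zero =>
        rw [hcore (Nat.zero_le _), hw0]
      | succ j =>
        by_cases hj : j + 1 ≤ n
        · rw [hcore hj, hws]
          have : s' j = s j := by simp only [s']; rw [if_pos (by omega)]
          simp only [this]
        · simp only [s', r', d]
          rw [if_neg (by omega), if_neg (by omega), if_neg (by omega), if_neg (by omega)]
          simp
    have h2 : Y (i+2) = (1/q + s' i) * y i := rfl
    rw [h2, hY]
    have h3 : Y i + (1/q + s' i) * y i + r' i / lam * y i + d i =
      Y i + 1/q * y i + (s' i * y i + r' i / lam * y i + d i) := by ring
    rw [h3, hkey]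
    cases i with
    | zero => rw [hY0, hl]; ring
    | succ j =>
      have := hs'0 j
      have h4 : 0 < 1 + q * s' j := by positivity
      rw [hY, hy, hl]
      field_simp
      ring
  · have h1 : ∑ i ∈ Finset.range (n+1+K), d i * Y (i+1) = s n * x n ^ 2 := by
      rw [Finset.sum_eq_single n]
      · simp only [d, if_true]
        rw [hY, hyx n le_rfl]; ring
      · intro i _ hi
        simp [d, hi]
      · intro h; exact absurd (Finset.mem_range.mpr (by omega)) h
    rw [h1]
    have h2 : Y (n+1+K+1) * Y (n+1+K) = ((1/q)^K * x n ^ 2) * (1/q)^(K+1) := by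
      have e1 : Y (n+1+K+1) = y (n + (K+1)) := by rw [hY]; congr 1; ring
      have e2 : Y (n+1+K) = y (n + K) := by
        rw [show n+1+K = (n+K)+1 by ring, hY]
      rw [e1, e2, hytail, hytail]; ring
    rw [h2]
    have h3 : (1/q)^(K+1) ≤ 1 := pow_le_one₀ (by positivity) (by rw [div_le_one hq0]; exact hq.le)
    have h4 : ((1/q)^K * x n ^ 2) * (1/q)^(K+1) ≤ (1/q)^K * x n ^ 2 :=
      mul_le_of_le_one_right (by positivity) h3
    linarith

/-- For `√(2+√5) ≤ a < b`, the spectral radius orders of numbers in `(a,b)` with finite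
spectral radius order are unbounded. -/
theorem kappa_unbounded_on_interval (a b : ℝ)
    (ha : Real.sqrt (2 + Real.sqrt 5) ≤ a) (hab : a < b) :
    ∀ M : ℕ, 0 < M → ∃ lam : ℝ, lam ∈ Set.Ioo a b ∧ kappa lam < ⊤ ∧ (M : ℕ∞) < kappa lam := by
  intro M _
  let S : Set ℝ := ⋃ n : Fin (M+1), Set.range (fun G : SimpleGraph (Fin n) => specRad G)
  have hS : S.Finite := Set.finite_iUnion (fun n => Set.finite_range _)
  obtain ⟨c, hc, hcS⟩ : ∃ c ∈ Set.Ioo a b, c ∉ S := by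
    by_contra! hcon
    exact (Set.Ioo_infinite hab) (hS.subset hcon)
  have hopen : IsOpen (Sᶜ ∩ Set.Ioo a b) := hS.isClosed.isOpen_compl.inter isOpen_Ioo
  obtain ⟨ε, hε, hball⟩ := Metric.isOpen_iff.mp hopen c ⟨hcS, hc⟩
  obtain ⟨N, r, h1, h2⟩ := density c (lt_of_le_of_lt ha hc.1) (ε/2) (by linarith)
  obtain ⟨G', hG'⟩ := specRad_transfer (cat N r)
  have hmem : specRad (cat N r) ∈ Sᶜ ∩ Set.Ioo a b := by
    apply hball
    rw [Metric.mem_ball, Real.dist_eq, abs_lt]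
    constructor <;> linarith
  refine ⟨specRad (cat N r), hmem.2, ?_, ?_⟩
  · exact lt_of_le_of_lt (sInf_le ⟨_, rfl, G', hG'⟩) (ENat.natCast_lt_top _)
  · have : ((M + 1 : ℕ) : ℕ∞) ≤ kappa (specRad (cat N r)) := by
      apply le_sInf
      rintro m ⟨n, rfl, G, hG⟩
      by_contra hlt
      rw [Nat.cast_le, not_le] at hlt
      exact hmem.1 (Set.mem_iUnion.mpr ⟨⟨n, hlt⟩, G, hG⟩)
    exact lt_of_lt_of_le (by exact_mod_cast Nat.lt_succ_self M) this
end

section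
/- Let b and c be integers with b ≤ 0 and c ≤ ⌊b²/4⌋, and let λ be the largest real root of the quadratic polynomial x² + bx + c (which has real roots since b² - 4c ≥ 0). Then there exists a finite simple graph G whose spectral radius λ₁(G) equals λ. -/
open Polynomial

theorem largestEig_eq_s9 {V : Type} [Fintype V] [DecidableEq V] (M : Matrix V V ℝ)
    (hM : ∀ i j, 0 ≤ M i j) (hs : ∀ i j, M i j = M j i) (f : V → ℝ) (hf : ∀ i, 0 < f i)
    [Nonempty V] (lam : ℝ) (h : ∀ i, ∑ j, M i j * f j = lam * f i) : largestEig M = lam := by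
  unfold largestEig
  apply IsGreatest.csSup_eq
  constructor
  · apply Module.End.hasEigenvalue_of_hasEigenvector (x := f)
    rw [Module.End.hasEigenvector_iff, Module.End.mem_eigenspace_iff]
    constructor
    · ext i
      simpa [Matrix.mulVec, dotProduct] using h i
    · intro h0
      obtain ⟨i⟩ := ‹Nonempty V›
      have := hf i
      simp [h0] at this
  · intro μ hμ
    obtain ⟨g, hg⟩ := Module.End.HasEigenvalue.exists_hasEigenvector hμ
    rw [Module.End.hasEigenvector_iff, Module.End.mem_eigenspace_iff] at hg
    obtain ⟨hg, hg0⟩ := hg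
    have hgi : ∀ i, ∑ j, M i j * g j = μ * g i := fun i => by
      simpa [Matrix.mulVec, dotProduct] using congrFun hg i
    have h1 : ∀ i, μ * |g i| ≤ ∑ j, M i j * |g j| := fun i => by
      calc μ * |g i| ≤ |μ| * |g i| := by gcongr; exact le_abs_self μ
        _ = |∑ j, M i j * g j| := by rw [hgi, abs_mul]
        _ ≤ ∑ j, |M i j * g j| := Finset.abs_sum_le_sum_abs _ _
        _ = _ := by simp [abs_mul, abs_of_nonneg (hM _ _)]
    have hpos : 0 < ∑ i, f i * |g i| := by
      obtain ⟨i, hi⟩ := Function.ne_iff.mp hg0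
      apply Finset.sum_pos' (fun i _ => mul_nonneg (hf i).le (abs_nonneg _))
      exact ⟨i, Finset.mem_univ _, mul_pos (hf i) (abs_pos.mpr hi)⟩
    have h2 : μ * ∑ i, f i * |g i| ≤ lam * ∑ i, f i * |g i| := by
      calc μ * ∑ i, f i * |g i| = ∑ i, f i * (μ * |g i|) := by
            rw [Finset.mul_sum]; exact Finset.sum_congr rfl fun i _ => by ring
        _ ≤ ∑ i, f i * ∑ j, M i j * |g j| :=
            Finset.sum_le_sum fun i _ => mul_le_mul_of_nonneg_left (h1 i) (hf i).le
        _ = ∑ j, (∑ i, M j i * f i) * |g j| := by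
            simp_rw [Finset.mul_sum, Finset.sum_mul]
            rw [Finset.sum_comm]
            refine Finset.sum_congr rfl fun i _ => Finset.sum_congr rfl fun j _ => ?_
            rw [hs i j]; ring
        _ = _ := by
            rw [Finset.mul_sum]
            exact Finset.sum_congr rfl fun i _ => by rw [h i]; ring
    exact le_of_mul_le_mul_right h2 hpos

open Classical in
theorem exists_specRad_of {V : Type} [Fintype V] [Nonempty V] (G : SimpleGraph V)
    (f : V → ℝ) (hf : ∀ i, 0 < f i) (lam : ℝ)
    (h : ∀ i, ∑ j, (if G.Adj i j then f j else 0) = lam * f i) :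
    ∃ (n : ℕ) (G : SimpleGraph (Fin n)), specRad G = lam := by
  let e := Fintype.equivFin V
  have : Nonempty (Fin (Fintype.card V)) := e.nonempty_congr.mp inferInstance
  refine ⟨Fintype.card V, G.comap e.symm, ?_⟩
  unfold specRad
  apply largestEig_eq_s9 _ _ _ (f ∘ e.symm) (fun i => hf _)
  · intro i
    rw [Function.comp, ← h (e.symm i), ← Equiv.sum_comp e.symm]
    refine Finset.sum_congr rfl fun j _ => ?_
    simp [SimpleGraph.adjMatrix_apply]
  · intro i j
    rw [SimpleGraph.adjMatrix_apply]
    split_ifs <;> norm_num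
  · intro i j
    simp only [SimpleGraph.adjMatrix_apply, SimpleGraph.adj_comm _ i j]
    congr

/-- The graph: `A`-vertices carry `none`, `B`-vertices carry `some t`. -/
def theGraph (a d k : ℕ) : SimpleGraph (Fin (a+1) × Fin (d+1) × Option (Fin k)) where
  Adj v w := match v, w with
    | (i, j, none), (i', j', none) => i ≠ i' ∧ j = j'
    | (i, j, some t), (i', j', some t') => i = i' ∧ j ≠ j' ∧ t = t'
    | (i, j, none), (i', j', some _) => i = i' ∧ j = j'
    | (i, j, some _), (i', j', none) => i = i' ∧ j = j'
  symm := ⟨by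
    rintro ⟨i, j, _ | t⟩ ⟨i', j', _ | t'⟩ <;> simp only <;> grind⟩
  loopless := ⟨by
    rintro ⟨i, j, _ | t⟩ <;> simp⟩

theorem adj_nn (a d k : ℕ) (i i' j j') :
    (theGraph a d k).Adj (i, j, none) (i', j', none) ↔ (j = j' ∧ ¬ i = i') := and_comm

theorem adj_ss (a d k : ℕ) (i i' j j' t t') :
    (theGraph a d k).Adj (i, j, some t) (i', j', some t') ↔ (i = i' ∧ t = t' ∧ ¬ j = j') := by
  change (i = i' ∧ j ≠ j' ∧ t = t') ↔ _
  tauto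

theorem adj_ns (a d k : ℕ) (i i' j j' t') :
    (theGraph a d k).Adj (i, j, none) (i', j', some t') ↔ (i = i' ∧ j = j') := Iff.rfl

theorem adj_sn (a d k : ℕ) (i i' j j' t) :
    (theGraph a d k).Adj (i, j, some t) (i', j', none) ↔ (i = i' ∧ j = j') := Iff.rfl

theorem sum_ne_const {n : ℕ} (i : Fin (n+1)) (x : ℝ) :
    ∑ j, (if i = j then 0 else x) = n * x := by
  have : ∀ j, (if i = j then 0 else x) = x - (if i = j then x else 0) := fun j => by
    split_ifs <;> ring
  simp [this]
  ring

theorem arith (a d k : ℝ) (lam : ℝ) (h : (lam - a) * (lam - d) = k) (had : a ≤ d)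
    (hl : a + d ≤ 2 * lam) (hk : 0 < k) : d < lam := by
  by_contra! hc
  nlinarith [mul_nonneg (show 0 ≤ lam - a by linarith) (show 0 ≤ d - lam by linarith)]

theorem real_case (a d k : ℕ) (lam : ℝ) (h : (lam - a) * (lam - d) = k) (had : a ≤ d)
    (hl : (a + d : ℝ) ≤ 2 * lam) : ∃ (n : ℕ) (G : SimpleGraph (Fin n)), specRad G = lam := by
  classical
  have had' : (a : ℝ) ≤ d := by exact_mod_cast had
  rcases Nat.eq_zero_or_pos k with rfl | hk
  · have hlam : lam = d := by
      rcases mul_eq_zero.mp (h.trans Nat.cast_zero) with h | h <;> linarith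
    apply exists_specRad_of (⊤ : SimpleGraph (Fin (d+1))) (fun _ => 1) (by simp)
    intro i
    rw [hlam, ← sum_ne_const i]
    refine Finset.sum_congr rfl fun j _ => ?_
    by_cases hij : i = j <;> simp [hij]
  · have hk' : (0 : ℝ) < k := by exact_mod_cast hk
    have hlt := arith a d k lam h had' hl hk'
    apply exists_specRad_of (theGraph a d k)
      (fun v => match v.2.2 with | none => lam - d | some _ => 1)
    · rintro ⟨i, j, _ | t⟩ <;> simp [hlt]
    · rintro ⟨i, j, _ | t⟩
      · simp only [Fintype.sum_prod_type, Fintype.sum_option, adj_nn, adj_ns,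
          Finset.sum_add_distrib, ite_and, ite_not]
        simp [sum_ne_const, Finset.sum_ite_irrel]
        linarith
      · simp only [Fintype.sum_prod_type, Fintype.sum_option, adj_sn, adj_ss,
          Finset.sum_add_distrib, ite_and, ite_not]
        simp [sum_ne_const, Finset.sum_ite_irrel]

/-- Let `b ≤ 0` and `c ≤ ⌊b²/4⌋` be integers, and let `λ` be the largest real root of
`x² + bx + c`. Then `λ` is the spectral radius of some finite simple graph. -/
theorem largest_root_realized_as_specRad (b c : ℤ) (hb : b ≤ 0)
    (hc : c ≤ ⌊((b : ℝ) ^ 2 / 4)⌋) (lam : ℝ)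
    (hroot : lam ^ 2 + (b : ℝ) * lam + (c : ℝ) = 0)
    (hmax : ∀ x : ℝ, x ^ 2 + (b : ℝ) * x + (c : ℝ) = 0 → x ≤ lam) :
    ∃ (n : ℕ) (G : SimpleGraph (Fin n)), specRad G = lam := by
  obtain ⟨s, rfl⟩ : ∃ s : ℕ, b = -(s : ℤ) := ⟨b.natAbs, by omega⟩
  have hc4 : 4 * c ≤ (s : ℤ) ^ 2 := by
    have h1 := Int.le_floor.mp hc
    have h2 : (4 * c : ℝ) ≤ (s : ℝ) ^ 2 := by
      push_cast at h1
      nlinarith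
    exact_mod_cast h2
  have hl : (s : ℝ) ≤ 2 * lam := by
    have := hmax (s - lam) (by push_cast at hroot ⊢; nlinarith)
    linarith
  obtain ⟨a, d, hs, had, hda⟩ : ∃ a d : ℕ, s = a + d ∧ a ≤ d ∧ d ≤ a + 1 :=
    ⟨s / 2, s - s / 2, by omega, by omega, by omega⟩
  have hk : 0 ≤ (a : ℤ) * d - c := by
    subst hs
    push_cast at hc4
    rcases (show d = a ∨ d = a + 1 by omega) with rfl | rfl
    · nlinarith
    · push_cast at hc4 ⊢
      have : 4 * c ≤ 4 * ((a : ℤ) * (a + 1)) + 1 := by linarith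
      omega
  obtain ⟨k, hk⟩ := Int.eq_ofNat_of_zero_le hk
  have hkr : (a : ℝ) * d - c = k := by exact_mod_cast hk
  subst hs
  push_cast at hroot hl
  exact real_case a d k lam (by rw [← hkr]; linarith) had hl
end
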